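/- Let n ≥ 2 be an integer. Then for every smooth function u : ℝⁿ → ℝ with compact support contained in the open unit ball Bⁿ, writing dV = (2/(1−|x|²))ⁿ dx and S(n,1) = n σₙ^{1/n}, one has (n−1)^n ( ∫_{Bⁿ} |u| dV )^n + S(n,1)^n ( ∫_{Bⁿ} |u|^{n/(n−1)} dV )^{n−1} ≤ ( ∫_{Bⁿ} ((1−|x|²)/2) |∇u| dV )^n. -/

import Mathlib

open Real MeasureTheory

/-- Volume of the Euclidean unit ball in `ℝⁿ`. -/
noncomputable def unitBallVol (n : ℕ) : ℝ := π ^ ((n : ℝ) / 2) / Real.Gamma ((n : ℝ) / 2 + 1)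

open Set Filter Topology

theorem unitBallVol_pos (n : ℕ) : 0 < unitBallVol n :=
  div_pos (rpow_pos_of_pos pi_pos _) (Gamma_pos_of_pos (by positivity))

theorem continuous_sqrt_one_sub_sq_pow (m : ℕ) : Continuous fun z : ℝ => √(1 - z ^ 2) ^ m := by
  fun_prop

theorem hasDerivAt_sqrt_one_sub_sq_pow (m : ℕ) {z : ℝ} (hz : z ∈ Ioo (-1 : ℝ) 1) :
    HasDerivAt (fun z : ℝ => √(1 - z ^ 2) ^ (m + 2)) (-(m + 2) * z * √(1 - z ^ 2) ^ m) z := by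
  have hpos : 0 < 1 - z ^ 2 := by nlinarith [hz.1, hz.2]
  have h1 : HasDerivAt (fun z : ℝ => 1 - z ^ 2) (-(2 * z)) z := by
    simpa using (hasDerivAt_pow 2 z).const_sub 1
  refine ((h1.sqrt hpos.ne').pow (m + 2)).congr_deriv ?_
  have hs : √(1 - z ^ 2) ≠ 0 := (sqrt_pos.2 hpos).ne'
  rw [show m + 2 - 1 = m + 1 from rfl, pow_succ]
  field_simp
  push_cast
  ring

theorem integral_sqrt_one_sub_sq_pow_add_two (m : ℕ) :
    (m + 3) * ∫ z in (-1 : ℝ)..1, √(1 - z ^ 2) ^ (m + 2) =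
      (m + 2) * ∫ z in (-1 : ℝ)..1, √(1 - z ^ 2) ^ m := by
  have hd : ∀ z ∈ Ioo (-1 : ℝ) 1, HasDerivAt (fun z : ℝ => z * √(1 - z ^ 2) ^ (m + 2))
      ((m + 3) * √(1 - z ^ 2) ^ (m + 2) - (m + 2) * √(1 - z ^ 2) ^ m) z := by
    intro z hz
    refine ((hasDerivAt_id z).mul (hasDerivAt_sqrt_one_sub_sq_pow m hz)).congr_deriv ?_
    have hpos : 0 ≤ 1 - z ^ 2 := by nlinarith [hz.1, hz.2]
    have := sq_sqrt hpos
    rw [pow_add, this]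
    simp only [id]
    ring
  have hi (k : ℕ) : IntervalIntegrable (fun z : ℝ => √(1 - z ^ 2) ^ k) volume (-1) 1 :=
    (continuous_sqrt_one_sub_sq_pow k).intervalIntegrable _ _
  have := intervalIntegral.integral_eq_sub_of_hasDerivAt_of_le (by norm_num : (-1 : ℝ) ≤ 1)
    (by fun_prop) hd (((hi _).const_mul _).sub ((hi _).const_mul _))
  rw [intervalIntegral.integral_sub ((hi _).const_mul _) ((hi _).const_mul _)] at this
  simp only [intervalIntegral.integral_const_mul] at this
  norm_num at this
  linarith

theorem unitBallVol_add_two (m : ℕ) :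
    (m + 2) * unitBallVol (m + 2) = 2 * π * unitBallVol m := by
  have h : ((m : ℝ) + 2) / 2 + 1 = (m / 2 + 1) + 1 := by ring
  have hG : Real.Gamma ((m : ℝ) / 2 + 1) ≠ 0 := (Gamma_pos_of_pos (by positivity)).ne'
  have hp : π ^ (((m : ℝ) + 2) / 2) = π ^ ((m : ℝ) / 2) * π := by
    rw [show ((m : ℝ) + 2) / 2 = m / 2 + 1 by ring, rpow_add_one pi_ne_zero]
  simp only [unitBallVol]
  push_cast
  rw [h, hp, Gamma_add_one (s := (m : ℝ) / 2 + 1) (by positivity)]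
  have : (m : ℝ) / 2 + 1 ≠ 0 := by positivity
  field_simp

theorem unitBallVol_zero : unitBallVol 0 = 1 := by simp [unitBallVol]

theorem unitBallVol_one : unitBallVol 1 = 2 := by
  have : (1 : ℝ) / 2 + 1 = 1 / 2 + 1 := rfl
  simp only [unitBallVol, Nat.cast_one]
  rw [Gamma_add_one (by norm_num), Gamma_one_half_eq, ← sqrt_eq_rpow]
  have : √π ≠ 0 := (sqrt_pos.2 pi_pos).ne'
  field_simp

theorem unitBallVol_two : unitBallVol 2 = π := by
  have := unitBallVol_add_two 0
  norm_num [unitBallVol_zero] at this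
  linarith

theorem unitBallVol_succ (m : ℕ) :
    unitBallVol (m + 1) = unitBallVol m * ∫ z in (-1 : ℝ)..1, √(1 - z ^ 2) ^ m := by
  induction m using Nat.twoStepInduction with
  | zero => simp [unitBallVol_zero, unitBallVol_one]; norm_num
  | one =>
    simp only [pow_one, integral_sqrt_one_sub_sq, unitBallVol_one, Nat.reduceAdd, unitBallVol_two]
    ring
  | more m ih _ =>
    have h1 := unitBallVol_add_two m
    have h2 := unitBallVol_add_two (m + 1)
    have h3 := integral_sqrt_one_sub_sq_pow_add_two m
    rw [ih] at h2
    push_cast at h2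
    have hm2 : ((m : ℝ) + 2) ≠ 0 := by positivity
    have hm3 : ((m : ℝ) + 3) ≠ 0 := by positivity
    have e1 : unitBallVol (m + 2) = 2 * π * unitBallVol m / (m + 2) := by
      rw [eq_div_iff hm2]; linarith
    have e3 : (∫ z in (-1 : ℝ)..1, √(1 - z ^ 2) ^ (m + 2)) =
        (m + 2) * (∫ z in (-1 : ℝ)..1, √(1 - z ^ 2) ^ m) / (m + 3) := by
      rw [eq_div_iff hm3]; linarith
    rw [e1, e3]
    apply mul_left_cancel₀ hm3
    rw [show m + 2 + 1 = m + 1 + 2 by ring]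
    rw [show ((m : ℝ) + 3) = m + 1 + 2 by ring, h2]
    field_simp

/-- Normalised volume `∫₀ʳ sinh^m` of a geodesic ball of radius `r` in `ℍ^{m+1}`. -/
noncomputable def sinhPowInt (m : ℕ) (r : ℝ) : ℝ := ∫ x in (0 : ℝ)..r, sinh x ^ m

theorem hasDerivAt_sinhPowInt (m : ℕ) (r : ℝ) : HasDerivAt (sinhPowInt m) (sinh r ^ m) r :=
  intervalIntegral.integral_hasDerivAt_right (Continuous.intervalIntegrable (by fun_prop) _ _)
    (Continuous.stronglyMeasurableAtFilter (by fun_prop) _ _)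
    (by fun_prop)

@[simp] theorem sinhPowInt_zero (m : ℕ) : sinhPowInt m 0 = 0 := by simp [sinhPowInt]

theorem sinhPowInt_nonneg (m : ℕ) {r : ℝ} (hr : 0 ≤ r) : 0 ≤ sinhPowInt m r :=
  intervalIntegral.integral_nonneg hr fun _ hx => pow_nonneg (sinh_nonneg_iff.2 hx.1) _

theorem le_of_hasDerivAt_le {f g f' g' : ℝ → ℝ} (hf : ∀ x, HasDerivAt f (f' x) x)
    (hg : ∀ x, HasDerivAt g (g' x) x) (h0 : f 0 ≤ g 0) (h : ∀ x, 0 < x → f' x ≤ g' x)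
    {r : ℝ} (hr : 0 ≤ r) : f r ≤ g r := by
  have hd : ∀ x, HasDerivAt (fun x => g x - f x) (g' x - f' x) x := fun x => (hg x).sub (hf x)
  have := monotoneOn_of_deriv_nonneg (convex_Ici (0 : ℝ))
    (fun x _ => (hd x).continuousAt.continuousWithinAt)
    (fun x _ => (hd x).differentiableAt.differentiableWithinAt)
    (fun x hx => by
      rw [interior_Ici] at hx
      rw [(hd x).deriv]
      linarith [h x hx]) (mem_Ici.2 le_rfl) (mem_Ici.2 hr) hr
  dsimp only at this
  linarith

theorem succ_mul_sinhPowInt_le (m : ℕ) {r : ℝ} (hr : 0 ≤ r) :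
    (m + 1) * sinhPowInt m r ≤ sinh r ^ (m + 1) := by
  refine le_of_hasDerivAt_le (fun x => (hasDerivAt_sinhPowInt m x).const_mul _)
    (fun x => (hasDerivAt_sinh x).pow (m + 1)) (by simp) (fun x hx => ?_) hr
  push_cast
  have hs := (sinh_pos_iff.2 hx).le
  have hc := one_le_cosh x
  have : 0 ≤ ((m : ℝ) + 1) * sinh x ^ m := by positivity
  nlinarith

theorem mul_sinhPowInt_le {m : ℕ} {r : ℝ} (hr : 0 ≤ r) : m * sinhPowInt m r ≤ sinh r ^ m := by
  refine le_of_hasDerivAt_le (fun x => (hasDerivAt_sinhPowInt m x).const_mul _)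
    (fun x => (hasDerivAt_sinh x).pow m) ?_ (fun x hx => ?_) hr
  · simp only [sinhPowInt_zero, mul_zero]; exact pow_nonneg (sinh_nonneg_iff.2 le_rfl) _
  · have hs := (sinh_pos_iff.2 hx).le
    have hc := (sinh_lt_cosh x).le
    rcases m with _ | m
    · simp
    · have : 0 ≤ (((m + 1 : ℕ) : ℝ)) * sinh x ^ m := by positivity
      simp only [Nat.add_sub_cancel, pow_succ]
      nlinarith

theorem sinhPowInt_pow_le_sinh_pow_mul_cosh (k : ℕ) {r : ℝ} (hr : 0 ≤ r) :
    ((k : ℝ) + 1) ^ (k + 1) * sinhPowInt (k + 1) r ^ (k + 1)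
      + ((k : ℝ) + 2) ^ k * sinhPowInt (k + 1) r ^ k ≤ sinh r ^ (k * (k + 2)) * cosh r := by
  have hW (x : ℝ) := hasDerivAt_sinhPowInt (k + 1) x
  refine le_of_hasDerivAt_le
    (fun x => (((hW x).pow (k + 1)).const_mul _).add (((hW x).pow k).const_mul _))
    (fun x => ((hasDerivAt_sinh x).pow (k * (k + 2))).mul (hasDerivAt_cosh x)) ?_
    (fun x hx => ?_) hr
  · rcases k with _ | k <;> simp
  · have hs := (sinh_pos_iff.2 hx).le
    have h1 := mul_sinhPowInt_le (m := k + 1) hx.le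
    have h2 := succ_mul_sinhPowInt_le (k + 1) hx.le
    have hW0 := sinhPowInt_nonneg (k + 1) hx.le
    set W := sinhPowInt (k + 1) x
    set s := sinh x
    have hc : cosh x ^ 2 = 1 + s ^ 2 := cosh_sq' x
    push_cast at h1 h2 ⊢
    rw [add_assoc, one_add_one_eq_two] at h2
    have a1 : (((k : ℝ) + 1) * W) ^ k ≤ (s ^ (k + 1)) ^ k :=
      pow_le_pow_left₀ (by positivity) h1 k
    have b1 : ((k : ℝ) + 1) ^ (k + 1) * ((k + 1) * W ^ k * s ^ (k + 1))
        ≤ (k + 1) ^ 2 * (s ^ (k * (k + 2)) * s) := by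
      calc _ = ((k : ℝ) + 1) ^ 2 * s ^ (k + 1) * (((k : ℝ) + 1) * W) ^ k := by rw [mul_pow]; ring
        _ ≤ ((k : ℝ) + 1) ^ 2 * s ^ (k + 1) * (s ^ (k + 1)) ^ k := by gcongr
        _ = _ := by ring
    rcases k with _ | j
    · simp at b1 ⊢
    have a2 : (((j : ℝ) + 1 + 2) * W) ^ j ≤ (s ^ (j + 1 + 1 + 1)) ^ j := by
      refine pow_le_pow_left₀ (by positivity) ?_ j
      push_cast at h2; exact h2
    have b2 : ((j : ℝ) + 1 + 2) ^ (j + 1) * ((j + 1) * W ^ j * s ^ (j + 1 + 1))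
        ≤ (j + 1) * (j + 1 + 2) * s ^ ((j + 1) * (j + 1 + 2) - 1) := by
      calc _ = ((j : ℝ) + 1) * (j + 1 + 2) * s ^ (j + 1 + 1) * (((j : ℝ) + 1 + 2) * W) ^ j := by
            rw [mul_pow]; ring
        _ ≤ ((j : ℝ) + 1) * (j + 1 + 2) * s ^ (j + 1 + 1) * (s ^ (j + 1 + 1 + 1)) ^ j := by gcongr
        _ = ((j : ℝ) + 1) * (j + 1 + 2) * s ^ ((j + 1 + 1) + (j + 1 + 1 + 1) * j) := by ring
        _ = _ := by
          congr 2
          have : (j + 1) * (j + 1 + 2) = (j + 1 + 1) + (j + 1 + 1 + 1) * j + 1 := by ring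
          omega
    have e : s ^ ((j + 1) * (j + 1 + 2)) = s ^ ((j + 1) * (j + 1 + 2) - 1) * s := by
      rw [← pow_succ]; congr 1
    simp only [Nat.add_sub_cancel, Pi.pow_apply]
    push_cast at b1 b2 ⊢
    refine (add_le_add b1 b2).trans (le_of_eq ?_)
    rw [e]
    linear_combination (-((j : ℝ) + 1) * (j + 1 + 2) * s ^ ((j + 1) * (j + 1 + 2) - 1)) * hc

theorem sinhPowInt_pow_le_sinh_pow (k : ℕ) {r : ℝ} (hr : 0 ≤ r) :
    ((k : ℝ) + 1) ^ (k + 2) * sinhPowInt (k + 1) r ^ (k + 2)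
      + ((k : ℝ) + 2) ^ (k + 1) * sinhPowInt (k + 1) r ^ (k + 1)
      ≤ sinh r ^ ((k + 1) * (k + 2)) := by
  have hW (x : ℝ) := hasDerivAt_sinhPowInt (k + 1) x
  refine le_of_hasDerivAt_le
    (fun x => (((hW x).pow (k + 2)).const_mul _).add (((hW x).pow (k + 1)).const_mul _))
    (fun x => ((hasDerivAt_sinh x).pow ((k + 1) * (k + 2)))) (by simp) (fun x hx => ?_) hr
  have hs := (sinh_pos_iff.2 hx).le
  have h := sinhPowInt_pow_le_sinh_pow_mul_cosh k hx.le
  set W := sinhPowInt (k + 1) x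
  set s := sinh x
  have e1 : (k + 1) * (k + 2) - 1 = k * (k + 2) + (k + 1) := by
    have : (k + 1) * (k + 2) = k * (k + 2) + (k + 1) + 1 := by ring
    omega
  have e2 : k + 2 - 1 = k + 1 := rfl
  rw [e1, e2]
  simp only [Nat.add_sub_cancel]
  push_cast
  have := mul_le_mul_of_nonneg_left h (by positivity :
    0 ≤ ((k : ℝ) + 1) * (k + 2) * s ^ (k + 1))
  refine le_trans (le_of_eq ?_) (this.trans (le_of_eq ?_)) <;> ring

/-- A monotone rearrangement with prescribed density ratio, with values in the open interval. -/
theorem exists_transport {k γ : ℝ → ℝ} (hk : ContinuousOn k (Icc (-1) 1))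
    (hk0 : ∀ z ∈ Ioo (-1 : ℝ) 1, 0 < k z) (hγ : Continuous γ) (hγ0 : ∀ y, 0 ≤ γ y)
    (hγi : Integrable γ) (hlt : ∫ y, γ y < ∫ z in (-1 : ℝ)..1, k z) :
    ∃ T : ℝ → ℝ, ∀ y, T y ∈ Ioo (-1 : ℝ) 1 ∧ HasDerivAt T (γ y / k (T y)) y := by
  set K : ℝ → ℝ := fun z => ∫ x in (-1 : ℝ)..z, k x with hK
  set δ : ℝ := ((∫ z in (-1 : ℝ)..1, k z) - ∫ y, γ y) / 2 with hδ
  have hδ0 : 0 < δ := by rw [hδ]; linarith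
  set Γ : ℝ → ℝ := fun y => δ + ∫ x in Iic y, γ x with hΓ
  have hki : IntervalIntegrable k volume (-1) 1 :=
    ContinuousOn.intervalIntegrable (by rwa [uIcc_of_le (by norm_num)])
  have hKd : ∀ z ∈ Ioo (-1 : ℝ) 1, HasDerivAt K (k z) z := fun z hz =>
    intervalIntegral.integral_hasDerivAt_right
      (hki.mono_set (uIcc_subset_uIcc_left (by
        rw [uIcc_of_le (by norm_num)]; exact Ioo_subset_Icc_self hz)))
      ((hk.mono Ioo_subset_Icc_self).stronglyMeasurableAtFilter isOpen_Ioo _ hz)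
      (hk.continuousAt (Icc_mem_nhds hz.1 hz.2))
  have hKc : ContinuousOn K (Icc (-1) 1) := by
    have := intervalIntegral.continuousOn_primitive_interval (μ := volume) (f := k)
      (a := -1) (b := 1) (by
        rw [uIcc_of_le (by norm_num)]; exact hk.integrableOn_Icc)
    rwa [uIcc_of_le (by norm_num)] at this
  have hKm : StrictMonoOn K (Icc (-1) 1) := by
    refine strictMonoOn_of_deriv_pos (convex_Icc _ _) hKc fun z hz => ?_
    rw [interior_Icc] at hz
    rw [(hKd z hz).deriv]
    exact hk0 z hz
  have hK0 : K (-1) = 0 := by simp [hK]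
  have hΓd : ∀ y, HasDerivAt Γ (γ y) y := by
    intro y
    have h1 : HasDerivAt (fun y => ∫ x in (0 : ℝ)..y, γ x) (γ y) y :=
      intervalIntegral.integral_hasDerivAt_right (hγ.intervalIntegrable _ _)
        (hγ.stronglyMeasurableAtFilter _ _) hγ.continuousAt
    have h2 := h1.const_add (δ + ∫ x in Iic 0, γ x)
    refine h2.congr_of_eventuallyEq (Eventually.of_forall fun z => ?_)
    have := intervalIntegral.integral_Iic_sub_Iic (μ := volume) (f := γ) (a := 0) (b := z)
      hγi.integrableOn hγi.integrableOn
    simp only [hΓ]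
    linarith
  have hΓm : ∀ y, Γ y ∈ Ioo 0 (K 1) := by
    intro y
    have h1 : 0 ≤ ∫ x in Iic y, γ x := setIntegral_nonneg measurableSet_Iic fun x _ => hγ0 x
    have h2 : ∫ x in Iic y, γ x ≤ ∫ x, γ x :=
      setIntegral_le_integral hγi (Eventually.of_forall hγ0)
    simp only [hΓ, hK, mem_Ioo]
    constructor <;> linarith
  have hsurj : ∀ a ∈ Ioo 0 (K 1), ∃ z ∈ Ioo (-1 : ℝ) 1, K z = a := by
    intro a ha
    rw [← hK0] at ha
    exact intermediate_value_Ioo (by norm_num) hKc ha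
  choose! S hS hKS using hsurj
  have hSm : StrictMonoOn S (Ioo 0 (K 1)) := by
    intro a ha b hb hab
    by_contra! h
    have := hKm.monotoneOn (Ioo_subset_Icc_self (hS b hb)) (Ioo_subset_Icc_self (hS a ha)) h
    rw [hKS a ha, hKS b hb] at this
    linarith
  have hSK : ∀ z ∈ Ioo (-1 : ℝ) 1, K z ∈ Ioo 0 (K 1) ∧ S (K z) = z := by
    intro z hz
    have hz' := Ioo_subset_Icc_self hz
    have h : K z ∈ Ioo 0 (K 1) := by
      rw [← hK0]
      exact ⟨hKm ⟨le_rfl, by norm_num⟩ hz' hz.1, hKm hz' ⟨by norm_num, le_rfl⟩ hz.2⟩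
    exact ⟨h, hKm.injOn (Ioo_subset_Icc_self (hS _ h)) hz' (hKS _ h)⟩
  have himg : S '' Ioo 0 (K 1) = Ioo (-1) 1 := by
    ext z
    constructor
    · rintro ⟨a, ha, rfl⟩; exact hS a ha
    · intro hz; exact ⟨K z, (hSK z hz).1, (hSK z hz).2⟩
  refine ⟨fun y => S (Γ y), fun y => ⟨hS _ (hΓm y), ?_⟩⟩
  have hSy := hS _ (hΓm y)
  have hSc : ContinuousAt S (Γ y) := hSm.continuousAt_of_image_mem_nhds
    (Ioo_mem_nhds (hΓm y).1 (hΓm y).2) (by rw [himg]; exact Ioo_mem_nhds hSy.1 hSy.2)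
  have hSd : HasDerivAt S (k (S (Γ y)))⁻¹ (Γ y) :=
    HasDerivAt.of_local_left_inverse hSc (hKd _ hSy) (hk0 _ hSy).ne'
      (by filter_upwards [Ioo_mem_nhds (hΓm y).1 (hΓm y).2] with a ha using hKS a ha)
  refine (hSd.comp y (hΓd y)).congr_deriv ?_
  rw [div_eq_mul_inv, mul_comm]

theorem integral_comp_transport_le {k γ ψ T : ℝ → ℝ} (hk : ContinuousOn k (Icc (-1) 1))
    (hk0 : ∀ z ∈ Ioo (-1 : ℝ) 1, 0 < k z) (hψ : ContinuousOn ψ (Icc (-1) 1))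
    (hψ0 : ∀ z ∈ Icc (-1 : ℝ) 1, 0 ≤ ψ z) (hγ : Continuous γ) (hγ0 : ∀ y, 0 ≤ γ y)
    (hγs : HasCompactSupport γ)
    (hT : ∀ y, T y ∈ Ioo (-1 : ℝ) 1 ∧ HasDerivAt T (γ y / k (T y)) y) :
    ∫ y, ψ (T y) * γ y ≤ ∫ z in (-1 : ℝ)..1, ψ z * k z := by
  have hTc : Continuous T := continuous_iff_continuousAt.2 fun y => (hT y).2.continuousAt
  have hkk : ∀ z ∈ Icc (-1 : ℝ) 1, 0 ≤ k z := by
    have hcl : Icc (-1 : ℝ) 1 = closure (Ioo (-1) 1) := (closure_Ioo (by norm_num)).symm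
    intro z hz
    have := isClosed_Ici.closure_subset ((hk.mono hcl.ge).image_closure ⟨z, hcl ▸ hz, rfl⟩ |>
      closure_mono (by rintro _ ⟨x, hx, rfl⟩; exact (hk0 x hx).le : k '' Ioo (-1) 1 ⊆ Ici 0))
    exact this
  obtain ⟨R, hR0, hR⟩ : ∃ R : ℝ, 0 < R ∧ tsupport γ ⊆ Ioc (-R) R := by
    obtain ⟨R, hR0, hR⟩ := hγs.isCompact.isBounded.subset_ball_lt 0 0
    refine ⟨R, hR0, hR.trans ?_⟩
    rw [Real.ball_eq_Ioo]
    intro x hx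
    exact ⟨by linarith [hx.1], by linarith [hx.2]⟩
  have h1 : ∫ y, ψ (T y) * γ y = ∫ y in (-R)..R, ψ (T y) * γ y := by
    rw [intervalIntegral.integral_eq_integral_of_support_subset]
    intro y hy
    exact hR (subset_tsupport _ (right_ne_zero_of_mul hy))
  have hmem : ∀ y, T y ∈ Icc (-1 : ℝ) 1 := fun y => Ioo_subset_Icc_self (hT y).1
  have hkT : Continuous fun y => k (T y) := hk.comp_continuous hTc hmem
  have hsub := intervalIntegral.integral_comp_mul_deriv' (a := -R) (b := R) (f := T)
    (f' := fun y => γ y / k (T y)) (g := fun z => ψ z * k z) (fun y _ => (hT y).2)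
    ((hγ.div hkT fun y => (hk0 _ (hT y).1).ne').continuousOn)
    ((hψ.mul hk).mono (by rintro _ ⟨y, -, rfl⟩; exact hmem y))
  have h2 : ∀ y, ((fun z => ψ z * k z) ∘ T) y * (γ y / k (T y)) = ψ (T y) * γ y := by
    intro y
    have := (hk0 _ (hT y).1).ne'
    simp only [Function.comp]
    field_simp
  simp only [h2] at hsub
  have hmono : Monotone T := monotone_of_deriv_nonneg (fun y => (hT y).2.differentiableAt)
    fun y => by rw [(hT y).2.deriv]; exact div_nonneg (hγ0 y) (hk0 _ (hT y).1).le
  rw [h1, hsub]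
  refine intervalIntegral.integral_mono_interval (hT _).1.1.le (hmono (by linarith))
    (hT _).1.2.le ?_ ?_
  · refine (ae_restrict_iff' measurableSet_Ioc).2 (Eventually.of_forall fun z hz => ?_)
    exact mul_nonneg (hψ0 z (Ioc_subset_Icc_self hz)) (hkk z (Ioc_subset_Icc_self hz))
  · refine ContinuousOn.intervalIntegrable ?_
    rw [uIcc_of_le (by norm_num)]
    exact hψ.mul hk

theorem sinh_mul_lt_cosh (r : ℝ) {w : ℝ} (hw : w ∈ Icc (-1 : ℝ) 1) : sinh r * w < cosh r := by
  have h1 : |sinh r * w| ≤ |sinh r| := by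
    rw [abs_mul]
    exact mul_le_of_le_one_right (abs_nonneg _) (abs_le.2 hw)
  have h2 : |sinh r| < cosh r := abs_lt_of_sq_lt_sq (by rw [cosh_sq]; linarith) (cosh_pos r).le
  exact (le_abs_self _).trans_lt (h1.trans_lt h2)

/-- Density on `(-1, 1)` describing the horospherical slices of a geodesic ball of radius `r`. -/
noncomputable def hypDensity (m : ℕ) (r w : ℝ) : ℝ :=
  unitBallVol m * (sinh r ^ (m + 1) * √(1 - w ^ 2) ^ m / (cosh r - sinh r * w))

/-- The derivative of `hypDensity` with respect to the radius. -/
noncomputable def hypFlux (m : ℕ) (r w : ℝ) : ℝ :=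
  unitBallVol m * (sinh r ^ m * √(1 - w ^ 2) ^ m * (m * cosh r * (cosh r - sinh r * w) + 1)
    / (cosh r - sinh r * w) ^ 2)

theorem continuousOn_hypDensity (m : ℕ) (r : ℝ) :
    ContinuousOn (hypDensity m r) (Icc (-1) 1) := by
  unfold hypDensity
  refine continuousOn_const.mul (ContinuousOn.div (by fun_prop) (by fun_prop) fun w hw => ?_)
  exact (sub_pos.2 (sinh_mul_lt_cosh r hw)).ne'

theorem continuousOn_hypFlux_uncurry (m : ℕ) :
    ContinuousOn (fun p : ℝ × ℝ => hypFlux m p.1 p.2) (univ ×ˢ Icc (-1) 1) := by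
  unfold hypFlux
  refine continuousOn_const.mul (ContinuousOn.div (by fun_prop) (by fun_prop) fun p hp => ?_)
  exact pow_ne_zero _ (sub_pos.2 (sinh_mul_lt_cosh p.1 hp.2)).ne'

theorem continuousOn_hypFlux (m : ℕ) (r : ℝ) : ContinuousOn (hypFlux m r) (Icc (-1) 1) :=
  (continuousOn_hypFlux_uncurry m).comp (f := fun w => (r, w)) (by fun_prop)
    fun _ hw => ⟨mem_univ _, hw⟩

theorem hypDensity_pos (m : ℕ) {r w : ℝ} (hr : 0 < r) (hw : w ∈ Ioo (-1 : ℝ) 1) :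
    0 < hypDensity m r w := by
  have h1 : 0 < √(1 - w ^ 2) := sqrt_pos.2 (by nlinarith [hw.1, hw.2])
  have h2 := sub_pos.2 (sinh_mul_lt_cosh r (Ioo_subset_Icc_self hw))
  have h3 := sinh_pos_iff.2 hr
  have := unitBallVol_pos m
  unfold hypDensity
  positivity

theorem hasDerivAt_hypDensity (m : ℕ) (r : ℝ) {w : ℝ} (hw : w ∈ Icc (-1 : ℝ) 1) :
    HasDerivAt (fun r => hypDensity m r w) (hypFlux m r w) r := by
  have h2 := (sub_pos.2 (sinh_mul_lt_cosh r hw)).ne'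
  unfold hypDensity hypFlux
  refine ((((hasDerivAt_sinh r).pow (m + 1)).mul_const _).div
    ((hasDerivAt_cosh r).sub ((hasDerivAt_sinh r).mul_const w)) h2).const_mul _ |>.congr_deriv ?_
  have hc := cosh_sq r
  push_cast
  simp only [Pi.pow_apply, Pi.sub_apply]
  congr 2
  linear_combination (sinh r ^ m * √(1 - w ^ 2) ^ m) * hc

theorem integral_hypFlux (m : ℕ) (r : ℝ) :
    ∫ w in (-1 : ℝ)..1, hypFlux m r w = (m + 1) * unitBallVol (m + 1) * sinh r ^ m := by
  have hne : ∀ w ∈ Icc (-1 : ℝ) 1, cosh r - sinh r * w ≠ 0 := fun w hw =>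
    (sub_pos.2 (sinh_mul_lt_cosh r hw)).ne'
  have hd : ∀ w ∈ Ioo (-1 : ℝ) 1, HasDerivAt
      (fun w => unitBallVol m * sinh r ^ m *
        (√(1 - w ^ 2) ^ (m + 2) * sinh r / (cosh r - sinh r * w)))
      ((m + 1) * (unitBallVol m * sinh r ^ m) * √(1 - w ^ 2) ^ m - hypFlux m r w) w := by
    intro w hw
    have h2 := hne w (Ioo_subset_Icc_self hw)
    refine ((((hasDerivAt_sqrt_one_sub_sq_pow m hw).mul_const _).div
      (((hasDerivAt_id w).const_mul (sinh r)).const_sub (cosh r)) h2).const_mul _).congr_deriv ?_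
    unfold hypFlux
    have hpos : 0 ≤ 1 - w ^ 2 := by nlinarith [hw.1, hw.2]
    have hc := cosh_sq r
    have hs := sq_sqrt hpos
    rw [pow_add, hs]
    simp only [id, mul_one]
    rw [eq_sub_iff_add_eq, mul_div_assoc', mul_div_assoc', ← add_div, div_eq_iff (pow_ne_zero 2 h2)]
    linear_combination (-unitBallVol m * sinh r ^ m * √(1 - w ^ 2) ^ m) * hc
  have hi : IntervalIntegrable (fun w : ℝ =>
      (m + 1) * (unitBallVol m * sinh r ^ m) * √(1 - w ^ 2) ^ m) volume (-1) 1 :=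
    Continuous.intervalIntegrable (by fun_prop) _ _
  have hF : IntervalIntegrable (hypFlux m r) volume (-1) 1 :=
    ContinuousOn.intervalIntegrable (by
      rw [uIcc_of_le (by norm_num)]; exact continuousOn_hypFlux m r)
  have := intervalIntegral.integral_eq_sub_of_hasDerivAt_of_le (by norm_num : (-1 : ℝ) ≤ 1)
    (continuousOn_const.mul (ContinuousOn.div (by fun_prop) (by fun_prop) hne)) hd (hi.sub hF)
  rw [intervalIntegral.integral_sub hi hF, intervalIntegral.integral_const_mul] at this
  norm_num at this
  rw [unitBallVol_succ]
  linarith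

theorem integral_hypDensity (m : ℕ) (r : ℝ) :
    ∫ w in (-1 : ℝ)..1, hypDensity m r w =
      (m + 1) * unitBallVol (m + 1) * sinhPowInt m r := by
  have h0 : ∀ w, hypDensity m 0 w = 0 := by simp [hypDensity]
  have h1 : ∀ w ∈ uIcc (-1 : ℝ) 1, hypDensity m r w = ∫ x in (0 : ℝ)..r, hypFlux m x w := by
    intro w hw
    rw [uIcc_of_le (by norm_num)] at hw
    rw [intervalIntegral.integral_eq_sub_of_hasDerivAt
      (fun x _ => hasDerivAt_hypDensity m x hw), h0, sub_zero]
    refine Continuous.intervalIntegrable ?_ _ _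
    exact (continuousOn_hypFlux_uncurry m).comp_continuous (f := fun x => (x, w)) (by fun_prop)
      fun x => ⟨mem_univ _, hw⟩
  rw [intervalIntegral.integral_congr h1, intervalIntegral_intervalIntegral_swap]
  · simp_rw [integral_hypFlux]
    rw [intervalIntegral.integral_const_mul, sinhPowInt]
  · have hc : ContinuousOn (Function.uncurry fun w x => hypFlux m x w)
        (uIcc (-1) 1 ×ˢ uIcc 0 r) := by
      refine (continuousOn_hypFlux_uncurry m).comp (f := fun p : ℝ × ℝ => (p.2, p.1))
        (by fun_prop) fun p hp => ⟨mem_univ _, ?_⟩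
      rw [uIcc_of_le (by norm_num)] at hp
      exact hp.1
    exact (hc.integrableOn_compact (isCompact_uIcc.prod isCompact_uIcc)).mono_set
      (prod_mono uIoc_subset_uIcc uIoc_subset_uIcc)

/-- A Gagliardo–Nirenberg form of the isoperimetric inequality in `ℝᵐ`. -/
def GagliardoNirenberg (m : ℕ) : Prop :=
  ∀ v : EuclideanSpace ℝ (Fin m) → ℝ, ContDiff ℝ 1 v → HasCompactSupport v → (∀ x, 0 ≤ v x) →
    (m : ℝ) ^ m * unitBallVol m * (∫ x, v x ^ (((m : ℝ) + 1) / m)) ^ m ≤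
      (∫ x, v x) * (∫ x, ‖fderiv ℝ v x‖) ^ m

/-- The Euclidean norm of the gradient of a function on the product `E × ℝ`. -/
noncomputable def gradNorm {E : Type*} [NormedAddCommGroup E] [NormedSpace ℝ E]
    (v : E × ℝ → ℝ) (z : E × ℝ) : ℝ :=
  √(‖(fderiv ℝ v z).comp (ContinuousLinearMap.inl ℝ E ℝ)‖ ^ 2 + fderiv ℝ v z (0, 1) ^ 2)

theorem le_of_pow_le_mul_pow {m : ℕ} (hm : 0 < m) {g a b : ℝ} (ha : 0 ≤ a) (hb : 0 ≤ b)
    (h : g ^ (m + 1) ≤ a * (b / m) ^ m) : (m + 1) * g ≤ a + b := by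
  rcases le_or_gt g 0 with hg | hg
  · nlinarith
  have hm' : (0 : ℝ) < m := by exact_mod_cast hm
  have h1 := Real.geom_mean_le_arith_mean2_weighted (w₁ := 1 / ((m : ℝ) + 1))
    (w₂ := m / ((m : ℝ) + 1)) (p₁ := a) (p₂ := b / m) (by positivity) (by positivity) ha
    (by positivity) (by field_simp; ring)
  have h2 : g = (g ^ (m + 1)) ^ (1 / ((m : ℝ) + 1)) := by
    rw [← rpow_natCast, ← rpow_mul hg.le]
    push_cast
    rw [mul_one_div_cancel (by positivity), rpow_one]
  have h3 : (a * (b / m) ^ m) ^ (1 / ((m : ℝ) + 1)) =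
      a ^ (1 / ((m : ℝ) + 1)) * (b / m) ^ ((m : ℝ) / (m + 1)) := by
    rw [mul_rpow ha (by positivity), ← rpow_natCast (b / m), ← rpow_mul (by positivity)]
    congr 2
    ring
  have h4 : g ≤ a ^ (1 / ((m : ℝ) + 1)) * (b / m) ^ ((m : ℝ) / (m + 1)) := by
    rw [← h3]
    conv_lhs => rw [h2]
    exact rpow_le_rpow (by positivity) h (by positivity)
  have h5 : g ≤ (a + b) / (m + 1) := (h4.trans h1).trans (le_of_eq (by field_simp))
  rw [le_div_iff₀ (by positivity)] at h5
  linarith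

theorem neg_mul_add_sqrt_mul_le {a b t : ℝ} (ht : |t| ≤ 1) :
    -b * t + √(1 - t ^ 2) * a ≤ √(a ^ 2 + b ^ 2) := by
  have h : 0 ≤ 1 - t ^ 2 := by have := (sq_le_one_iff_abs_le_one t).2 ht; linarith
  have hs := sq_sqrt h
  apply le_sqrt_of_sq_le
  nlinarith [sq_nonneg (a * t + √(1 - t ^ 2) * b)]

theorem continuous_mul_comp_snd {X : Type*} [TopologicalSpace X] {f : X × ℝ → ℝ} {h : ℝ → ℝ} {O : Set ℝ} (hf : Continuous f)
    (hO : IsOpen O) (hh : ContinuousOn h O) (hfO : ∀ z ∈ tsupport f, z.2 ∈ O) :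
    Continuous fun z => f z * h z.2 := by
  refine ContinuousOn.continuous_of_tsupport_subset (s := Prod.snd ⁻¹' O)
    (hf.continuousOn.mul (hh.comp continuous_snd.continuousOn fun z hz => hz))
    (hO.preimage continuous_snd) fun z hz => hfO z ?_
  exact closure_mono (fun w hw => left_ne_zero_of_mul hw) hz

theorem HasCompactSupport.comp_mk_left {X Y : Type*} [TopologicalSpace X] [TopologicalSpace Y]
    [R1Space Y] {f : X × Y → ℝ} (hf : HasCompactSupport f) (x : X) :
    HasCompactSupport fun y => f (x, y) :=
  HasCompactSupport.intro (hf.isCompact.image continuous_snd) fun y hy => by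
    by_contra h
    exact hy ⟨(x, y), subset_tsupport _ h, rfl⟩

theorem HasCompactSupport.comp_mk_right {X Y : Type*} [TopologicalSpace X] [TopologicalSpace Y]
    [R1Space X] {f : X × Y → ℝ} (hf : HasCompactSupport f) (y : Y) :
    HasCompactSupport fun x => f (x, y) :=
  HasCompactSupport.intro (hf.isCompact.image continuous_fst) fun x hx => by
    by_contra h
    exact hx ⟨(x, y), subset_tsupport _ h, rfl⟩

section Slices

variable {E : Type*} [NormedAddCommGroup E] [NormedSpace ℝ E]

theorem gradNorm_nonneg (v : E × ℝ → ℝ) (z : E × ℝ) : 0 ≤ gradNorm v z := sqrt_nonneg _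

theorem continuous_gradNorm {v : E × ℝ → ℝ} (hv : ContDiff ℝ 1 v) : Continuous (gradNorm v) := by
  have h := hv.continuous_fderiv one_ne_zero
  unfold gradNorm
  have h1 : Continuous fun z => (fderiv ℝ v z).comp (ContinuousLinearMap.inl ℝ E ℝ) :=
    h.clm_comp continuous_const
  have h2 : Continuous fun z => fderiv ℝ v z (0, 1) := h.clm_apply continuous_const
  fun_prop

theorem tsupport_gradNorm_subset (v : E × ℝ → ℝ) : tsupport (gradNorm v) ⊆ tsupport v := by
  refine (closure_mono fun z hz => ?_).trans (tsupport_fderiv_subset ℝ)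
  intro h
  exact hz (by simp [gradNorm, h])

theorem integral_fderiv_snd_eq_zero [MeasurableSpace E] [BorelSpace E] [FiniteDimensional ℝ E]
    {μ : Measure E} [IsFiniteMeasureOnCompacts μ] [SFinite μ] {w w' : E × ℝ → ℝ}
    (hw : Continuous w) (hws : HasCompactSupport w) (hw' : Continuous w')
    (hws' : HasCompactSupport w')
    (hd : ∀ x y, HasDerivAt (fun y => w (x, y)) (w' (x, y)) y) :
    ∫ z, w' z ∂(μ.prod volume) = 0 := by
  rw [integral_prod _ (hw'.integrable_of_hasCompactSupport hws')]
  refine integral_eq_zero_of_ae (Eventually.of_forall fun x => ?_)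
  exact integral_eq_zero_of_hasDerivAt_of_integrable (hd x)
    ((hw'.comp (Continuous.prodMk_right x)).integrable_of_hasCompactSupport (hws'.comp_mk_left x))
    ((hw.comp (Continuous.prodMk_right x)).integrable_of_hasCompactSupport (hws.comp_mk_left x))

end Slices

/-- Lower bound for a weighted total variation by slicing along the last coordinate, from a
one-dimensional transport map `T` and the Gagliardo–Nirenberg inequality on the slices. -/
theorem le_integral_gradNorm_mul {m : ℕ} (hm : 0 < m) (hGN : GagliardoNirenberg m)
    {v : EuclideanSpace ℝ (Fin m) × ℝ → ℝ} (hv : ContDiff ℝ 1 v) (hvs : HasCompactSupport v)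
    (hv0 : ∀ z, 0 ≤ v z) {O : Set ℝ} (hO : IsOpen O) (hvO : ∀ z ∈ tsupport v, z.2 ∈ O)
    {p p' T T' g : ℝ → ℝ} (hp : ∀ y ∈ O, HasDerivAt p (p' y) y)
    (hT : ∀ y ∈ O, HasDerivAt T (T' y) y) (hp' : ContinuousOn p' O) (hT' : ContinuousOn T' O)
    (hp0 : ∀ y ∈ O, 0 < p y) (hT1 : ∀ y ∈ O, |T y| ≤ 1) (hT0 : ∀ y ∈ O, 0 ≤ T' y)
    (hgi : Integrable g) (hgO : ∀ y ∉ O, g y ≤ 0)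
    (hg : ∀ y ∈ O, g y ^ (m + 1) ≤ p y ^ (m + 1) * T' y * √(1 - T y ^ 2) ^ m *
      unitBallVol m * (∫ x, v (x, y) ^ (((m : ℝ) + 1) / m)) ^ m) :
    (∫ z, v z * (p' z.2 * T z.2)) + (m + 1) * ∫ y, g y ≤ ∫ z, gradNorm v z * p z.2 := by
  have hpc : ContinuousOn p O := fun y hy => (hp y hy).continuousAt.continuousWithinAt
  have hTc : ContinuousOn T O := fun y hy => (hT y hy).continuousAt.continuousWithinAt
  set b : EuclideanSpace ℝ (Fin m) × ℝ → ℝ := fun z => fderiv ℝ v z (0, 1) with hb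
  set q : EuclideanSpace ℝ (Fin m) × ℝ → ℝ := fun z =>
    ‖(fderiv ℝ v z).comp (ContinuousLinearMap.inl ℝ (EuclideanSpace ℝ (Fin m)) ℝ)‖ with hq
  have hfc := hv.continuous_fderiv one_ne_zero
  have hbc : Continuous b := hfc.clm_apply continuous_const
  have hqc : Continuous q := (hfc.clm_comp continuous_const).norm
  have hbs : tsupport b ⊆ tsupport v :=
    (closure_mono fun z (hz : b z ≠ 0) (h : fderiv ℝ v z = 0) => hz (by simp [hb, h])).trans
      (tsupport_fderiv_subset ℝ)
  have hqs : tsupport q ⊆ tsupport v :=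
    (closure_mono fun z (hz : q z ≠ 0) (h : fderiv ℝ v z = 0) => hz (by simp [hq, h])).trans
      (tsupport_fderiv_subset ℝ)
  have key : ∀ {f : EuclideanSpace ℝ (Fin m) × ℝ → ℝ} {h : ℝ → ℝ}, Continuous f →
      tsupport f ⊆ tsupport v → ContinuousOn h O →
      (Continuous fun z => f z * h z.2) ∧ HasCompactSupport fun z => f z * h z.2 := by
    intro f h hf hfs hh
    exact ⟨continuous_mul_comp_snd hf hO hh fun z hz => hvO z (hfs hz),
      HasCompactSupport.mul_right (f := f) (hvs.of_isClosed_subset (isClosed_tsupport _) hfs)⟩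
  have keyi : ∀ {f : EuclideanSpace ℝ (Fin m) × ℝ → ℝ} {h : ℝ → ℝ}, Continuous f →
      tsupport f ⊆ tsupport v → ContinuousOn h O →
      Integrable (fun z => f z * h z.2) (volume.prod volume) := by
    intro f h hf hfs hh
    exact (key hf hfs hh).1.integrable_of_hasCompactSupport (key hf hfs hh).2
  have hvc := hv.continuous
  -- integration by parts
  have i1 := keyi hbc hbs (hpc.mul hTc)
  have i2 := keyi hvc subset_rfl (hp'.mul hTc)
  have i3 := keyi hvc subset_rfl (hpc.mul hT')
  have hρc : ContinuousOn (fun y => √(1 - T y ^ 2)) O :=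
    ((continuousOn_const (c := (1 : ℝ))).sub (hTc.pow 2)).sqrt
  have i4 := keyi hqc hqs (hpc.mul hρc)
  have i5 := keyi (continuous_gradNorm hv) (tsupport_gradNorm_subset v) hpc
  simp only [Pi.mul_apply] at i1 i2 i3 i4 i5
  have hparts : ∫ z, ((b z * (p z.2 * T z.2) + v z * (p' z.2 * T z.2)) +
      v z * (p z.2 * T' z.2)) ∂(volume.prod volume) = 0 := by
    have c1 := key hbc hbs (hpc.mul hTc)
    have c2 := key hvc subset_rfl (hp'.mul hTc)
    have c3 := key hvc subset_rfl (hpc.mul hT')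
    have c4 := key hvc subset_rfl (hpc.mul hTc)
    refine integral_fderiv_snd_eq_zero c4.1 c4.2 ((c1.1.add c2.1).add c3.1)
      ((c1.2.add c2.2).add c3.2) fun x y => ?_
    have hd1 : HasDerivAt (fun y => v (x, y)) (b (x, y)) y := by
      have := ((hv.differentiable one_ne_zero (x, y)).hasFDerivAt).comp_hasDerivAt y
        ((hasDerivAt_const y x).prodMk (hasDerivAt_id y))
      exact this
    by_cases hy : y ∈ O
    · refine (hd1.mul ((hp y hy).mul (hT y hy))).congr_deriv ?_
      simp only [Pi.mul_apply]
      ring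
    · have hz : (x, y) ∉ tsupport v := fun h => hy (hvO _ h)
      have h0 : v (x, y) = 0 := image_eq_zero_of_notMem_tsupport hz
      have h0' : b (x, y) = 0 := image_eq_zero_of_notMem_tsupport fun h => hz (hbs h)
      have hev : (fun y => v (x, y) * (p y * T y)) =ᶠ[𝓝 y] fun _ => 0 := by
        have : ∀ᶠ w in 𝓝 (x, y), v w = 0 := notMem_tsupport_iff_eventuallyEq.1 hz
        filter_upwards [(Continuous.prodMk_right x).continuousAt.eventually this] with y' hy'
        simp only [hy', zero_mul]
      simp only [h0, h0', zero_mul, add_zero]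
      exact (hasDerivAt_const y (0 : ℝ)).congr_of_eventuallyEq hev
  rw [integral_add (by exact i1.add i2) i3, integral_add i1 i2] at hparts
  -- pointwise Cauchy–Schwarz
  have hpt : ∫ z, (-(b z * (p z.2 * T z.2)) + q z * (p z.2 * √(1 - T z.2 ^ 2)))
      ∂(volume.prod volume) ≤ ∫ z, gradNorm v z * p z.2 ∂(volume.prod volume) := by
    refine integral_mono (i1.neg.add i4) i5 fun z => ?_
    by_cases hz : z.2 ∈ O
    · have := mul_le_mul_of_nonneg_right
        (neg_mul_add_sqrt_mul_le (a := q z) (b := b z) (hT1 _ hz)) (hp0 _ hz).le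
      simp only [gradNorm]
      linarith
    · have hz' : z ∉ tsupport v := fun h => hz (hvO _ h)
      have h0' : b z = 0 := image_eq_zero_of_notMem_tsupport fun h => hz' (hbs h)
      have h0'' : q z = 0 := image_eq_zero_of_notMem_tsupport fun h => hz' (hqs h)
      have h1 : gradNorm v z = 0 :=
        image_eq_zero_of_notMem_tsupport fun h => hz' (tsupport_gradNorm_subset v h)
      simp [h0', h0'', h1]
  rw [integral_add (by exact i1.neg) i4, integral_neg] at hpt
  -- slices
  have hsl : (m + 1) * ∫ y, g y ≤ (∫ z, v z * (p z.2 * T' z.2) ∂(volume.prod volume)) +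
      ∫ z, q z * (p z.2 * √(1 - T z.2 ^ 2)) ∂(volume.prod volume) := by
    rw [← integral_const_mul, integral_prod_symm _ i3, integral_prod_symm _ i4,
      ← integral_add i3.integral_prod_right i4.integral_prod_right]
    refine integral_mono (hgi.const_mul _) (i3.integral_prod_right.add i4.integral_prod_right)
      fun y => ?_
    simp only [integral_mul_const]
    by_cases hy : y ∈ O
    · have hB : 0 ≤ ∫ x, v (x, y) := integral_nonneg fun x => hv0 _
      have hQ : 0 ≤ ∫ x, q (x, y) := integral_nonneg fun x => norm_nonneg _
      have hp0y := hp0 y hy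
      have hT0y := hT0 y hy
      refine le_of_pow_le_mul_pow hm (by positivity) (by positivity) ((hg y hy).trans ?_)
      have hsm : ContDiff ℝ 1 fun x => v (x, y) := hv.comp (contDiff_prodMk_left y)
      have hgn := hGN (fun x => v (x, y)) hsm (hvs.comp_mk_right y) fun x => hv0 _
      have hfd : ∀ x, ‖fderiv ℝ (fun x => v (x, y)) x‖ = q (x, y) := by
        intro x
        have h2 : HasFDerivAt v (fderiv ℝ v (x, y)) (x, y) :=
          (hv.differentiable one_ne_zero (x, y)).hasFDerivAt
        have h3 := HasFDerivAt.comp (g := v) (f := fun e => (e, y)) x h2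
          (hasFDerivAt_prodMk_left x y)
        exact congrArg norm h3.fderiv
      simp only [hfd] at hgn
      have hm' : (0 : ℝ) < m := by exact_mod_cast hm
      have h1 : p y ^ (m + 1) * T' y * √(1 - T y ^ 2) ^ m *
          ((m : ℝ) ^ m * unitBallVol m * (∫ x, v (x, y) ^ (((m : ℝ) + 1) / m)) ^ m) ≤
          p y ^ (m + 1) * T' y * √(1 - T y ^ 2) ^ m *
          ((∫ x, v (x, y)) * (∫ x, q (x, y)) ^ m) :=
        mul_le_mul_of_nonneg_left hgn (by positivity)
      rw [div_pow, mul_div_assoc', le_div_iff₀ (by positivity)]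
      calc _ = _ := by ring
        _ ≤ _ := h1
        _ = _ := by ring
    · have h0 : ∀ x, v (x, y) = 0 := fun x =>
        image_eq_zero_of_notMem_tsupport fun h => hy (hvO _ h)
      have h0' : ∀ x, q (x, y) = 0 := fun x =>
        image_eq_zero_of_notMem_tsupport fun h => hy (hvO _ (hqs h))
      simp only [h0, h0', integral_zero, zero_mul, add_zero]
      exact mul_nonpos_of_nonneg_of_nonpos (by positivity) (hgO y hy)
  rw [Measure.volume_eq_prod]
  linarith

theorem Continuous.integral_mk_right {X Y : Type*} [TopologicalSpace X] [TopologicalSpace Y]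
    [R1Space X] [MeasurableSpace X] [OpensMeasurableSpace X] [FirstCountableTopology Y]
    [LocallyCompactSpace Y] [SecondCountableTopologyEither X ℝ]
    {μ : Measure X} [IsLocallyFiniteMeasure μ] {f : X × Y → ℝ} (hf : Continuous f) (hfs : HasCompactSupport f) :
    Continuous fun y => ∫ x, f (x, y) ∂μ := by
  have h := continuous_parametric_integral_of_continuous (μ := μ)
    (f := fun (y : Y) (x : X) => f (x, y)) (hf.comp continuous_swap)
    (hfs.isCompact.image continuous_fst)
  refine h.congr fun y => ?_
  refine setIntegral_eq_integral_of_forall_compl_eq_zero fun x hx => ?_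
  by_contra h0
  exact hx ⟨(x, y), subset_tsupport _ h0, rfl⟩

theorem HasCompactSupport.integral_mk_right {X Y : Type*} [TopologicalSpace X]
    [TopologicalSpace Y] [R1Space Y] [MeasurableSpace X] {μ : Measure X} {f : X × Y → ℝ}
    (hfs : HasCompactSupport f) : HasCompactSupport fun y => ∫ x, f (x, y) ∂μ :=
  HasCompactSupport.intro (hfs.isCompact.image continuous_snd) fun y hy => by
    refine integral_eq_zero_of_ae (Eventually.of_forall fun x => ?_)
    by_contra h0
    exact hy ⟨(x, y), subset_tsupport _ h0, rfl⟩

theorem hasCompactSupport_rpow {X : Type*} [TopologicalSpace X] {v : X → ℝ}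
    (hv : HasCompactSupport v) {a : ℝ} (ha : a ≠ 0) : HasCompactSupport fun x => v x ^ a :=
  hv.comp_left (g := fun t : ℝ => t ^ a) (zero_rpow ha)

theorem integral_rpow_pow_le {X : Type*} [MeasurableSpace X] {μ : Measure X} {v : X → ℝ}
    (hv0 : ∀ x, 0 ≤ v x) {m : ℕ} (hm : 0 < m) (h1 : Integrable v μ)
    (h2 : Integrable (fun x => v x ^ (((m : ℝ) + 1) / m)) μ) :
    (∫ x, v x ^ ((((m + 1 : ℕ) : ℝ) + 1) / (m + 1 : ℕ)) ∂μ) ^ (m + 1) ≤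
      (∫ x, v x ∂μ) * (∫ x, v x ^ (((m : ℝ) + 1) / m) ∂μ) ^ m := by
  have hm' : (0 : ℝ) < m := by exact_mod_cast hm
  set n : ℝ := (m : ℝ) + 1 with hn
  have hn0 : 0 < n := by positivity
  have hpq : n.HolderConjugate (n / m) := by
    have := Real.HolderConjugate.conjExponent (p := n) (by linarith)
    simpa [Real.conjExponent, hn] using this
  have e1 : ∀ x, (v x ^ (1 / n)) ^ n = v x := fun x => by
    rw [← rpow_mul (hv0 x), one_div_mul_cancel hn0.ne', rpow_one]
  have e2 : ∀ x, (v x ^ (1 : ℝ)) ^ (n / m) = v x ^ (n / m) := fun x => by rw [rpow_one]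
  have m1 : MemLp (fun x => v x ^ (1 / n)) (ENNReal.ofReal n) μ := by
    rw [← integrable_norm_rpow_iff ((h1.aestronglyMeasurable.aemeasurable.pow_const _).aestronglyMeasurable)
      (by simpa using hn0) ENNReal.ofReal_ne_top]
    simp only [ENNReal.toReal_ofReal hn0.le, norm_of_nonneg (rpow_nonneg (hv0 _) _), e1]
    exact h1
  have m2 : MemLp v (ENNReal.ofReal (n / m)) μ := by
    rw [← integrable_norm_rpow_iff h1.aestronglyMeasurable
      (by simpa using div_pos hn0 hm') ENNReal.ofReal_ne_top]
    simp only [ENNReal.toReal_ofReal (div_pos hn0 hm').le, norm_of_nonneg (hv0 _)]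
    exact h2
  have h := integral_mul_le_Lp_mul_Lq_of_nonneg hpq
    (Eventually.of_forall fun x => rpow_nonneg (hv0 x) (1 / n)) (Eventually.of_forall hv0) m1 m2
  simp only [e1] at h
  have e3 : ∀ x, v x ^ ((((m + 1 : ℕ) : ℝ) + 1) / (m + 1 : ℕ)) = v x ^ (1 / n) * v x := by
    intro x
    rcases (hv0 x).eq_or_lt with h0 | h0
    · rw [← h0, mul_zero, zero_rpow (by positivity)]
    · rw [← rpow_add_one h0.ne']
      congr 1
      push_cast
      rw [← hn, add_div, div_self hn0.ne', add_comm]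
  simp only [e3]
  have hA : 0 ≤ ∫ x, v x ∂μ := integral_nonneg hv0
  have hB : 0 ≤ ∫ x, v x ^ (n / m) ∂μ := integral_nonneg fun x => rpow_nonneg (hv0 x) _
  calc _ ≤ ((∫ x, v x ∂μ) ^ (1 / n) * (∫ x, v x ^ (n / m) ∂μ) ^ (1 / (n / m))) ^ (m + 1) :=
        pow_le_pow_left₀ (integral_nonneg fun x => mul_nonneg (rpow_nonneg (hv0 x) _) (hv0 x)) h _
    _ = _ := by
      rw [mul_pow, ← rpow_mul_natCast hA, ← rpow_mul_natCast hB]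
      have a1 : 1 / n * ((m + 1 : ℕ) : ℝ) = 1 := by push_cast; field_simp; exact hn.symm
      have a2 : 1 / (n / m) * ((m + 1 : ℕ) : ℝ) = m := by push_cast; field_simp; exact hn.symm
      rw [a1, a2, rpow_one, rpow_natCast]

/-- The Euclidean Sobolev inequality on the product `ℝᵐ × ℝ`. -/
theorem sobolev_prod_of_gagliardoNirenberg {m : ℕ} (hm : 0 < m) (hGN : GagliardoNirenberg m)
    {v : EuclideanSpace ℝ (Fin m) × ℝ → ℝ} (hv : ContDiff ℝ 1 v) (hvs : HasCompactSupport v)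
    (hv0 : ∀ z, 0 ≤ v z) :
    ((m : ℝ) + 1) ^ (m + 1) * unitBallVol (m + 1) * (∫ z, v z ^ (((m : ℝ) + 1) / m)) ^ m ≤
      (∫ z, gradNorm v z) ^ (m + 1) := by
  have hm' : (0 : ℝ) < m := by exact_mod_cast hm
  set a : ℝ := ((m : ℝ) + 1) / m with ha
  have ha0 : 0 < a := by positivity
  have hwc : Continuous fun z => v z ^ a := hv.continuous.rpow_const fun _ => Or.inr ha0.le
  have hws : HasCompactSupport fun z => v z ^ a := hasCompactSupport_rpow hvs ha0.ne'
  set G : ℝ → ℝ := fun y => ∫ x, v (x, y) ^ a with hG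
  have hGc : Continuous G := hwc.integral_mk_right hws
  have hGs : HasCompactSupport G := hws.integral_mk_right
  have hG0 : ∀ y, 0 ≤ G y := fun y => integral_nonneg fun x => rpow_nonneg (hv0 _) _
  have hGi : Integrable G := hGc.integrable_of_hasCompactSupport hGs
  have hV : ∫ z, v z ^ a = ∫ y, G y := by
    rw [Measure.volume_eq_prod]
    exact integral_prod_symm _ (hwc.integrable_of_hasCompactSupport hws)
  rw [hV]
  set V := ∫ y, G y with hVdef
  have hV0 : 0 ≤ V := integral_nonneg hG0
  set P := ∫ z, gradNorm v z with hP
  have hP0 : 0 ≤ P := integral_nonneg fun z => gradNorm_nonneg _ _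
  have hs := unitBallVol_pos m
  have hs1 := unitBallVol_pos (m + 1)
  have main : ∀ K, V < K → ((m : ℝ) + 1) ^ (m + 1) * unitBallVol (m + 1) * V ^ (m + 1) ≤
      K * P ^ (m + 1) := by
    intro K hK
    have hK0 : 0 < K := hV0.trans_lt hK
    set k : ℝ → ℝ := fun z => K / unitBallVol (m + 1) * unitBallVol m * √(1 - z ^ 2) ^ m with hk
    have hkc : Continuous k := by fun_prop
    have hρ : ∀ z ∈ Ioo (-1 : ℝ) 1, 0 < √(1 - z ^ 2) := fun z hz =>
      sqrt_pos.2 (by nlinarith [hz.1, hz.2])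
    have hkpos : ∀ z ∈ Ioo (-1 : ℝ) 1, 0 < k z := fun z hz => by
      have := hρ z hz
      positivity
    have hkint : ∫ z in (-1 : ℝ)..1, k z = K := by
      rw [hk, intervalIntegral.integral_const_mul, mul_assoc, ← unitBallVol_succ]
      field_simp
    obtain ⟨T, hT⟩ := exists_transport hkc.continuousOn hkpos hGc hG0 hGi (hkint ▸ hK)
    have hTc : Continuous T := continuous_iff_continuousAt.2 fun y => (hT y).2.continuousAt
    set c : ℝ := (unitBallVol (m + 1) / K) ^ (1 / ((m : ℝ) + 1)) with hc
    have hc0 : 0 ≤ c := by positivity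
    have hcp : c ^ (m + 1) = unitBallVol (m + 1) / K := by
      rw [hc, ← rpow_mul_natCast (by positivity)]
      push_cast
      rw [one_div_mul_cancel (by positivity), rpow_one]
    have := le_integral_gradNorm_mul hm hGN hv hvs hv0 isOpen_univ (fun _ _ => mem_univ _)
      (p := fun _ => 1) (p' := fun _ => 0) (T := T) (T' := fun y => G y / k (T y))
      (g := fun y => G y * c) (fun y _ => hasDerivAt_const y 1) (fun y _ => (hT y).2)
      continuousOn_const
      (hGc.div (hkc.comp hTc) fun y => (hkpos _ (hT y).1).ne').continuousOn
      (fun _ _ => one_pos) (fun y _ => abs_le.2 ⟨(hT y).1.1.le, (hT y).1.2.le⟩)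
      (fun y _ => div_nonneg (hG0 y) (hkpos _ (hT y).1).le) (hGi.mul_const c)
      (fun y hy => absurd (mem_univ y) hy) fun y _ => by
        have h1 := hρ _ (hT y).1
        rw [mul_pow, hcp]
        apply le_of_eq
        simp only [hk]
        field_simp
        rw [one_pow, one_mul]
        ring
    simp only [zero_mul, mul_zero, integral_zero, zero_add, mul_one] at this
    rw [integral_mul_const] at this
    have h2 := pow_le_pow_left₀ (by positivity) this (m + 1)
    rw [mul_pow, mul_pow, hcp] at h2
    calc _ = K * ((m + 1) ^ (m + 1) * (V ^ (m + 1) * (unitBallVol (m + 1) / K))) := by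
          field_simp
      _ ≤ _ := mul_le_mul_of_nonneg_left h2 hK0.le
  have lim : ((m : ℝ) + 1) ^ (m + 1) * unitBallVol (m + 1) * V ^ (m + 1) ≤ V * P ^ (m + 1) := by
    have ht : Tendsto (fun K : ℝ => K * P ^ (m + 1)) (𝓝[>] V) (𝓝 (V * P ^ (m + 1))) :=
      ((continuous_id.mul continuous_const).tendsto V).mono_left nhdsWithin_le_nhds
    exact ge_of_tendsto ht (by filter_upwards [self_mem_nhdsWithin] with K hK using main K hK)
  rcases hV0.eq_or_lt with h0 | h0
  · rw [← h0, zero_pow hm.ne', mul_zero]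
    positivity
  · rw [pow_succ V, ← mul_assoc, mul_comm V] at lim
    exact le_of_mul_le_mul_right lim h0

theorem nonempty_linearIsometryEquiv_of_finrank_eq {V W : Type*} [NormedAddCommGroup V]
    [InnerProductSpace ℝ V] [FiniteDimensional ℝ V] [NormedAddCommGroup W]
    [InnerProductSpace ℝ W] [FiniteDimensional ℝ W]
    (h : Module.finrank ℝ V = Module.finrank ℝ W) : Nonempty (V ≃ₗᵢ[ℝ] W) :=
  ⟨(stdOrthonormalBasis ℝ V).equiv (stdOrthonormalBasis ℝ W) (finCongr h)⟩

theorem exists_prod_equiv (m : ℕ) :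
    ∃ φ : (EuclideanSpace ℝ (Fin m) × ℝ) ≃L[ℝ] EuclideanSpace ℝ (Fin (m + 1)),
      MeasurePreserving φ ∧ ∀ z, ‖φ z‖ = √(‖z.1‖ ^ 2 + z.2 ^ 2) := by
  have hfr : Module.finrank ℝ (WithLp 2 (EuclideanSpace ℝ (Fin m) × ℝ)) =
      Module.finrank ℝ (EuclideanSpace ℝ (Fin (m + 1))) := by
    rw [(WithLp.linearEquiv 2 ℝ (EuclideanSpace ℝ (Fin m) × ℝ)).finrank_eq]
    simp
  obtain ⟨ι⟩ := nonempty_linearIsometryEquiv_of_finrank_eq hfr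
  refine ⟨(WithLp.prodContinuousLinearEquiv 2 ℝ (EuclideanSpace ℝ (Fin m)) ℝ).symm.trans
    ι.toContinuousLinearEquiv, ?_, fun z => ?_⟩
  · exact ι.measurePreserving.comp (WithLp.volume_preserving_toLp _ _)
  · have : ‖ι (WithLp.toLp 2 z)‖ = √(‖z.1‖ ^ 2 + z.2 ^ 2) := by
      rw [ι.norm_map, WithLp.prod_norm_eq_of_L2]
      simp
    exact this

theorem gradNorm_comp_le {m : ℕ} {F : Type*} [NormedAddCommGroup F] [NormedSpace ℝ F]
    (φ : (EuclideanSpace ℝ (Fin m) × ℝ) ≃L[ℝ] F)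
    (hφ : ∀ z, ‖φ z‖ = √(‖z.1‖ ^ 2 + z.2 ^ 2)) {u : F → ℝ}
    (hu : Differentiable ℝ u) (z) : gradNorm (u ∘ φ) z ≤ ‖fderiv ℝ u (φ z)‖ := by
  have hd : fderiv ℝ (u ∘ φ) z = (fderiv ℝ u (φ z)).comp (φ : _ →L[ℝ] F) := by
    rw [fderiv_comp z (hu _) φ.differentiableAt, φ.fderiv]
  set L := (fderiv ℝ (u ∘ φ) z).comp (ContinuousLinearMap.inl ℝ (EuclideanSpace ℝ (Fin m)) ℝ)
    with hL
  set s := fderiv ℝ (u ∘ φ) z (0, 1) with hs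
  set a := (InnerProductSpace.toDual ℝ (EuclideanSpace ℝ (Fin m))).symm L with ha
  have han : ‖a‖ = ‖L‖ := LinearIsometryEquiv.norm_map _ _
  have h1 : fderiv ℝ (u ∘ φ) z (a, s) = ‖L‖ ^ 2 + s ^ 2 := by
    have e : ((a, s) : EuclideanSpace ℝ (Fin m) × ℝ) = (a, 0) + s • (0, 1) := by simp
    rw [e, map_add, map_smul, ← hs, ← han, ← real_inner_self_eq_norm_sq, smul_eq_mul, ← sq]
    congr 1
    rw [ha, InnerProductSpace.toDual_symm_apply, ← ha, hL]
    rfl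
  have h2 : fderiv ℝ (u ∘ φ) z (a, s) ≤ ‖fderiv ℝ u (φ z)‖ * √(‖L‖ ^ 2 + s ^ 2) := by
    rw [hd]
    refine (le_abs_self _).trans (((fderiv ℝ u (φ z)).le_opNorm _).trans ?_)
    have e : ‖φ (a, s)‖ = √(‖L‖ ^ 2 + s ^ 2) := by rw [← han]; exact hφ _
    exact le_of_eq (congrArg _ e)
  rw [h1] at h2
  have h3 : gradNorm (u ∘ φ) z = √(‖L‖ ^ 2 + s ^ 2) := rfl
  rw [h3]
  rcases (sqrt_nonneg (‖L‖ ^ 2 + s ^ 2)).eq_or_lt with h0 | h0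
  · rw [← h0]; exact norm_nonneg _
  · refine le_of_mul_le_mul_right ?_ h0
    rwa [mul_self_sqrt (by positivity)]

theorem GagliardoNirenberg.succ {m : ℕ} (hm : 0 < m) (hGN : GagliardoNirenberg m) :
    GagliardoNirenberg (m + 1) := by
  intro u hu hus hu0
  obtain ⟨φ, hφm, hφn⟩ := exists_prod_equiv m
  have hem : MeasurableEmbedding φ := φ.toHomeomorph.measurableEmbedding
  have hm' : (0 : ℝ) < m := by exact_mod_cast hm
  have hv : ContDiff ℝ 1 (u ∘ φ) := hu.comp φ.contDiff
  have hvs : HasCompactSupport (u ∘ φ) := hus.comp_homeomorph φ.toHomeomorph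
  have hsob := sobolev_prod_of_gagliardoNirenberg hm hGN hv hvs fun z => hu0 _
  have ha0 : 0 < ((m : ℝ) + 1) / m := by positivity
  have hint := integral_rpow_pow_le hu0 hm (hu.continuous.integrable_of_hasCompactSupport hus)
    ((hu.continuous.rpow_const fun _ => Or.inr ha0.le).integrable_of_hasCompactSupport
      (hasCompactSupport_rpow hus ha0.ne') : Integrable _ volume)
  have e1 : ∫ z, (u ∘ φ) z ^ (((m : ℝ) + 1) / m) = ∫ x, u x ^ (((m : ℝ) + 1) / m) :=
    hφm.integral_comp hem fun x => u x ^ (((m : ℝ) + 1) / m)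
  have hfc : Continuous fun x => ‖fderiv ℝ u x‖ := (hu.continuous_fderiv one_ne_zero).norm
  have hfs : HasCompactSupport fun x => ‖fderiv ℝ u x‖ := (hus.fderiv ℝ).norm
  have e2 : ∫ z, gradNorm (u ∘ φ) z ≤ ∫ x, ‖fderiv ℝ u x‖ := by
    rw [← hφm.integral_comp hem]
    refine integral_mono_of_nonneg (Eventually.of_forall fun z => gradNorm_nonneg _ _)
      ((hφm.integrable_comp_emb hem).2 (hfc.integrable_of_hasCompactSupport hfs))
      (Eventually.of_forall fun z => gradNorm_comp_le φ hφn (hu.differentiable one_ne_zero) z)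
  rw [e1] at hsob
  have h0 : 0 ≤ ∫ x, u x := integral_nonneg hu0
  have h3 : 0 ≤ ∫ z, gradNorm (u ∘ φ) z := integral_nonneg fun z => gradNorm_nonneg _ _
  have hs1 := unitBallVol_pos (m + 1)
  calc _ ≤ ((m + 1 : ℕ) : ℝ) ^ (m + 1) * unitBallVol (m + 1) *
        ((∫ x, u x) * (∫ x, u x ^ (((m : ℝ) + 1) / m)) ^ m) := by gcongr
    _ = (∫ x, u x) * (((m : ℝ) + 1) ^ (m + 1) * unitBallVol (m + 1) *
        (∫ x, u x ^ (((m : ℝ) + 1) / m)) ^ m) := by push_cast; ring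
    _ ≤ _ := by gcongr; exact hsob.trans (pow_le_pow_left₀ h3 e2 _)

theorem gagliardoNirenberg_one : GagliardoNirenberg 1 := by
  intro u hu hus hu0
  obtain ⟨ι⟩ := nonempty_linearIsometryEquiv_of_finrank_eq
    (V := ℝ) (W := EuclideanSpace ℝ (Fin 1)) (by simp)
  have hem : MeasurableEmbedding ι := ι.toHomeomorph.measurableEmbedding
  have hmp : MeasurePreserving ι := ι.measurePreserving
  have hw : ContDiff ℝ 1 (u ∘ ι) := hu.comp ι.contDiff
  have hws : HasCompactSupport (u ∘ ι) := hus.comp_homeomorph ι.toHomeomorph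
  have hfc : Continuous fun x => ‖fderiv ℝ u x‖ := (hu.continuous_fderiv one_ne_zero).norm
  have hfs : HasCompactSupport fun x => ‖fderiv ℝ u x‖ := (hus.fderiv ℝ).norm
  set q := ∫ x, ‖fderiv ℝ u x‖ with hq
  have hder : ∀ y, |deriv (u ∘ ι) y| ≤ ‖fderiv ℝ u (ι y)‖ := by
    intro y
    have h := ((hu.differentiable one_ne_zero (ι y)).hasFDerivAt.comp_hasDerivAt y
      ι.toContinuousLinearEquiv.hasFDerivAt.hasDerivAt).deriv
    rw [h]
    refine ((fderiv ℝ u (ι y)).le_opNorm _).trans (le_of_eq ?_)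
    have : ‖ι 1‖ = 1 := by rw [ι.norm_map]; simp
    exact (congrArg _ this).trans (mul_one _)
  have hdi : Integrable (deriv (u ∘ ι)) :=
    (hw.continuous_deriv le_rfl).integrable_of_hasCompactSupport hws.deriv
  have hq' : ∫ y, |deriv (u ∘ ι) y| ≤ q := by
    rw [hq, ← hmp.integral_comp hem]
    exact integral_mono hdi.abs
      ((hmp.integrable_comp_emb hem).2 (hfc.integrable_of_hasCompactSupport hfs)) hder
  have hpt : ∀ y, 2 * u (ι y) ≤ q := by
    intro y
    have h1 := HasCompactSupport.integral_Iic_deriv_eq hw hws y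
    have h2 := HasCompactSupport.integral_Ioi_deriv_eq hw hws y
    have h3 : ∫ x in Iic y, deriv (u ∘ ι) x ≤ ∫ x in Iic y, |deriv (u ∘ ι) x| :=
      integral_mono hdi.integrableOn hdi.abs.integrableOn fun x => le_abs_self _
    have h4 : -∫ x in Ioi y, deriv (u ∘ ι) x ≤ ∫ x in Ioi y, |deriv (u ∘ ι) x| := by
      rw [← integral_neg]
      exact integral_mono hdi.neg.integrableOn hdi.abs.integrableOn fun x => neg_le_abs _
    have h5 := intervalIntegral.integral_Iic_add_Ioi (b := y) hdi.abs.integrableOn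
      hdi.abs.integrableOn
    simp only [Function.comp] at h1 h2 h3 h4 h5 hq'
    linarith
  have hpt' : ∀ x, 2 * u x ≤ q := fun x => by simpa using hpt (ι.symm x)
  have hui : Integrable u := hu.continuous.integrable_of_hasCompactSupport hus
  rw [unitBallVol_one]
  norm_num
  rw [← integral_const_mul, ← integral_mul_const]
  refine integral_mono_of_nonneg (Eventually.of_forall fun x => mul_nonneg zero_le_two (sq_nonneg (u x)))
    (hui.mul_const q) (Eventually.of_forall fun x => ?_)
  have := mul_le_mul_of_nonneg_left (hpt' x) (hu0 x)
  simp only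
  linarith

theorem gagliardoNirenberg {m : ℕ} (hm : 0 < m) : GagliardoNirenberg m := by
  induction m, hm using Nat.le_induction with
  | base => exact gagliardoNirenberg_one
  | succ k hk ih => exact ih.succ hk

theorem pow_le_succ_mul_sinhPowInt (m : ℕ) {r : ℝ} (hr : 0 ≤ r) :
    r ^ (m + 1) ≤ (m + 1) * sinhPowInt m r := by
  have h1 : ∫ x in (0 : ℝ)..r, x ^ m ≤ sinhPowInt m r := by
    refine intervalIntegral.integral_mono_on hr (Continuous.intervalIntegrable (by fun_prop) _ _)
      (Continuous.intervalIntegrable (by fun_prop) _ _) fun x hx => ?_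
    exact pow_le_pow_left₀ hx.1 (self_le_sinh_iff.2 hx.1) m
  rw [integral_pow, zero_pow (by lia), sub_zero, div_le_iff₀ (by positivity)] at h1
  linarith

theorem strictMonoOn_sinhPowInt (m : ℕ) : StrictMonoOn (sinhPowInt m) (Ici 0) := by
  refine strictMonoOn_of_deriv_pos (convex_Ici 0)
    (fun x _ => (hasDerivAt_sinhPowInt m x).continuousAt.continuousWithinAt) fun x hx => ?_
  rw [interior_Ici] at hx
  rw [(hasDerivAt_sinhPowInt m x).deriv]
  exact pow_pos (sinh_pos_iff.2 hx) m

theorem exists_sinhPowInt_eq (m : ℕ) {C : ℝ} (hC : 0 < C) : ∃ r, 0 < r ∧ sinhPowInt m r = C := by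
  set R : ℝ := (m + 1) * C + 1 with hR
  have hR1 : 1 ≤ R := by have : 0 ≤ ((m : ℝ) + 1) * C := by positivity
                         linarith
  have h1 : C ≤ sinhPowInt m R := by
    have h2 := pow_le_succ_mul_sinhPowInt m (zero_le_one.trans hR1)
    have h3 : R ≤ R ^ (m + 1) := le_self_pow₀ hR1 (by lia)
    have : (0 : ℝ) < m + 1 := by positivity
    nlinarith
  obtain ⟨r, hr, hrC⟩ := intermediate_value_Icc (zero_le_one.trans hR1)
    (f := sinhPowInt m) (fun x _ => (hasDerivAt_sinhPowInt m x).continuousAt.continuousWithinAt)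
    ⟨by rw [sinhPowInt_zero]; exact hC.le, h1⟩
  refine ⟨r, hr.1.lt_of_ne fun h => ?_, hrC⟩
  rw [← h, sinhPowInt_zero] at hrC
  exact hC.ne hrC

/-- The hyperbolic translation of the interval `(-1, 1)`. -/
noncomputable def mobiusShift (r w : ℝ) : ℝ := (cosh r * w - sinh r) / (cosh r - sinh r * w)

theorem one_sub_mobiusShift_sq (r : ℝ) {w : ℝ} (hw : w ∈ Icc (-1 : ℝ) 1) :
    1 - mobiusShift r w ^ 2 = (1 - w ^ 2) / (cosh r - sinh r * w) ^ 2 := by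
  have h := (sub_pos.2 (sinh_mul_lt_cosh r hw)).ne'
  have hc := cosh_sq r
  unfold mobiusShift
  rw [div_pow, eq_div_iff (pow_ne_zero 2 h), sub_mul, div_mul_cancel₀ _ (pow_ne_zero 2 h)]
  linear_combination (1 - w ^ 2) * hc

theorem abs_mobiusShift_le_one (r : ℝ) {w : ℝ} (hw : w ∈ Icc (-1 : ℝ) 1) :
    |mobiusShift r w| ≤ 1 := by
  rw [← sq_le_one_iff_abs_le_one]
  have h1 := one_sub_mobiusShift_sq r hw
  have h2 : 0 ≤ (1 - w ^ 2) / (cosh r - sinh r * w) ^ 2 :=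
    div_nonneg (by nlinarith [hw.1, hw.2]) (sq_nonneg _)
  linarith

theorem hasDerivAt_mobiusShift (r : ℝ) {w : ℝ} (hw : w ∈ Icc (-1 : ℝ) 1) :
    HasDerivAt (mobiusShift r) (1 / (cosh r - sinh r * w) ^ 2) w := by
  have h := (sub_pos.2 (sinh_mul_lt_cosh r hw)).ne'
  refine ((((hasDerivAt_id w).const_mul (cosh r)).sub_const (sinh r)).div
    (((hasDerivAt_id w).const_mul (sinh r)).const_sub (cosh r)) h).congr_deriv ?_
  simp only [id, mul_one]
  congr 1
  linear_combination cosh_sq r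

theorem coth_add_mobiusShift {r : ℝ} (hr : 0 < r) {w : ℝ} (hw : w ∈ Icc (-1 : ℝ) 1) :
    cosh r / sinh r + mobiusShift r w = 1 / (sinh r * (cosh r - sinh r * w)) := by
  have h := (sub_pos.2 (sinh_mul_lt_cosh r hw)).ne'
  have hs := (sinh_pos_iff.2 hr).ne'
  unfold mobiusShift
  rw [div_add_div _ _ hs h]
  congr 1
  linear_combination cosh_sq r

theorem hypFlux_eq (m : ℕ) {r : ℝ} (hr : 0 < r) {w : ℝ} (hw : w ∈ Icc (-1 : ℝ) 1) :
    hypFlux m r w = (m * (cosh r / sinh r) + (cosh r / sinh r + mobiusShift r w)) *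
      hypDensity m r w := by
  have h := (sub_pos.2 (sinh_mul_lt_cosh r hw)).ne'
  have hs := (sinh_pos_iff.2 hr).ne'
  rw [coth_add_mobiusShift hr hw]
  unfold hypFlux hypDensity
  set D := cosh r - sinh r * w with hD
  field_simp
  ring

theorem integral_mobiusShift_mul_ge {m : ℕ} {r : ℝ} (hr : 0 < r) {γ ω : ℝ → ℝ}
    (hγ : Continuous γ) (hγ0 : ∀ y, 0 ≤ γ y) (hγs : HasCompactSupport γ)
    (hω : ∀ y, ω y ∈ Ioo (-1 : ℝ) 1 ∧ HasDerivAt ω (γ y / hypDensity m r (ω y)) y) :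
    (m + 1) * unitBallVol (m + 1) * sinh r ^ m -
      ((m + 1) * (cosh r / sinh r) + 1) *
        ((m + 1) * unitBallVol (m + 1) * sinhPowInt m r - ∫ y, γ y) ≤
      (∫ y, mobiusShift r (ω y) * γ y) + (m + 1) * (cosh r / sinh r) * ∫ y, γ y := by
  have hMc : ContinuousOn (mobiusShift r) (Icc (-1) 1) := fun w hw =>
    (hasDerivAt_mobiusShift r hw).continuousAt.continuousWithinAt
  have hωc : Continuous ω := continuous_iff_continuousAt.2 fun y => (hω y).2.continuousAt
  have hMω : Continuous fun y => mobiusShift r (ω y) :=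
    hMc.comp_continuous hωc fun y => Ioo_subset_Icc_self (hω y).1
  have hγi : Integrable γ := hγ.integrable_of_hasCompactSupport hγs
  have hMi : Integrable fun y => mobiusShift r (ω y) * γ y :=
    (hMω.mul hγ).integrable_of_hasCompactSupport (hγs.mul_left)
  have h := integral_comp_transport_le (continuousOn_hypDensity m r)
    (fun z hz => hypDensity_pos m hr hz) (ψ := fun w => 1 - mobiusShift r w)
    (continuousOn_const.sub hMc)
    (fun z hz => by have := (abs_le.1 (abs_mobiusShift_le_one r hz)).2; linarith) hγ hγ0 hγs hω
  have e1 : ∫ y, (1 - mobiusShift r (ω y)) * γ y =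
      (∫ y, γ y) - ∫ y, mobiusShift r (ω y) * γ y := by
    rw [← integral_sub hγi hMi]
    exact integral_congr_ae (Eventually.of_forall fun y => by simp only; ring)
  have e2 : ∫ z in (-1 : ℝ)..1, (1 - mobiusShift r z) * hypDensity m r z =
      ((m + 1) * (cosh r / sinh r) + 1) * ((m + 1) * unitBallVol (m + 1) * sinhPowInt m r) -
        (m + 1) * unitBallVol (m + 1) * sinh r ^ m := by
    rw [← integral_hypDensity, ← integral_hypFlux, ← intervalIntegral.integral_const_mul,
      ← intervalIntegral.integral_sub]
    · refine intervalIntegral.integral_congr fun w hw => ?_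
      rw [uIcc_of_le (by norm_num)] at hw
      rw [hypFlux_eq m hr hw]
      ring
    · refine ContinuousOn.intervalIntegrable ?_
      rw [uIcc_of_le (by norm_num)]
      exact continuousOn_const.mul (continuousOn_hypDensity m r)
    · refine ContinuousOn.intervalIntegrable ?_
      rw [uIcc_of_le (by norm_num)]
      exact continuousOn_hypFlux m r
  rw [e1, e2] at h
  linarith

theorem le_integral_gradNorm_mul_of_lt {m : ℕ} (hm : 0 < m)
    {v : EuclideanSpace ℝ (Fin m) × ℝ → ℝ} (hv : ContDiff ℝ 1 v) (hvs : HasCompactSupport v)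
    (hvO : ∀ z ∈ tsupport v, 0 < z.2) (hv0 : ∀ z, 0 ≤ v z) (hv1 : ∀ z, v z ≤ 1) {r : ℝ}
    (hr : 0 < r)
    (hC : ∫ z, v z ^ (((m : ℝ) + 1) / m) * (z.2 ^ (m + 1))⁻¹ <
      (m + 1) * unitBallVol (m + 1) * sinhPowInt m r) :
    (m + 1) * unitBallVol (m + 1) * sinh r ^ m -
      ((m + 1) * (cosh r / sinh r) + 1) * ((m + 1) * unitBallVol (m + 1) * sinhPowInt m r -
        ∫ z, v z ^ (((m : ℝ) + 1) / m) * (z.2 ^ (m + 1))⁻¹) ≤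
      (∫ z, gradNorm v z * (z.2 ^ m)⁻¹) +
        m * ∫ z, (v z - v z ^ (((m : ℝ) + 1) / m)) * (z.2 ^ (m + 1))⁻¹ := by
  have hm' : (0 : ℝ) < m := by exact_mod_cast hm
  set a : ℝ := ((m : ℝ) + 1) / m with ha
  have ha0 : 0 < a := by positivity
  have ha1 : 1 ≤ a := by rw [ha, one_le_div hm']; linarith
  have hwc : Continuous fun z => v z ^ a := hv.continuous.rpow_const fun _ => Or.inr ha0.le
  have hws : HasCompactSupport fun z => v z ^ a := hasCompactSupport_rpow hvs ha0.ne'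
  have hwO : ∀ z ∈ tsupport (fun z => v z ^ a), z.2 ∈ Ioi (0 : ℝ) := fun z hz =>
    hvO z (closure_mono (fun w (hw : v w ^ a ≠ 0) (h : v w = 0) =>
      hw (by simp only [h, zero_rpow ha0.ne'])) hz)
  have hpc : ∀ k : ℕ, ContinuousOn (fun y : ℝ => (y ^ k)⁻¹) (Ioi 0) := fun k =>
    (continuousOn_pow k).inv₀ fun y hy => (pow_pos hy k).ne'
  have hfc : Continuous fun z => v z ^ a * (z.2 ^ (m + 1))⁻¹ :=
    continuous_mul_comp_snd hwc isOpen_Ioi (hpc _) hwO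
  have hfs : HasCompactSupport fun z => v z ^ a * (z.2 ^ (m + 1))⁻¹ := hws.mul_right
  have hvpc : Continuous fun z => v z * (z.2 ^ (m + 1))⁻¹ :=
    continuous_mul_comp_snd hv.continuous isOpen_Ioi (hpc _) hvO
  have hvps : HasCompactSupport fun z => v z * (z.2 ^ (m + 1))⁻¹ := hvs.mul_right
  set γ : ℝ → ℝ := fun y => ∫ x, v (x, y) ^ a * (y ^ (m + 1))⁻¹ with hγdef
  have hγc : Continuous γ := hfc.integral_mk_right hfs
  have hγs : HasCompactSupport γ := hfs.integral_mk_right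
  have hγO : ∀ y ∉ Ioi (0 : ℝ), γ y = 0 := by
    intro y hy
    have : ∀ x, v (x, y) = 0 := fun x =>
      image_eq_zero_of_notMem_tsupport fun h => hy (hvO _ h)
    simp [hγdef, this, zero_rpow ha0.ne']
  have hγ0 : ∀ y, 0 ≤ γ y := by
    intro y
    by_cases hy : y ∈ Ioi (0 : ℝ)
    · exact integral_nonneg fun x =>
        mul_nonneg (rpow_nonneg (hv0 _) _) (inv_nonneg.2 (pow_pos hy _).le)
    · exact (hγO y hy).ge
  have hγi : Integrable γ := hγc.integrable_of_hasCompactSupport hγs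
  have hCγ : ∫ z, v z ^ a * (z.2 ^ (m + 1))⁻¹ = ∫ y, γ y := by
    rw [Measure.volume_eq_prod]
    exact integral_prod_symm _ (hfc.integrable_of_hasCompactSupport hfs)
  rw [hCγ] at hC ⊢
  rw [← integral_hypDensity] at hC
  obtain ⟨ω, hω⟩ := exists_transport (continuousOn_hypDensity m r)
    (fun z hz => hypDensity_pos m hr hz) hγc hγ0 hγi hC
  have hωI : ∀ y, ω y ∈ Icc (-1 : ℝ) 1 := fun y => Ioo_subset_Icc_self (hω y).1
  have hωc : Continuous ω := continuous_iff_continuousAt.2 fun y => (hω y).2.continuousAt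
  have hD : ∀ y, 0 < cosh r - sinh r * ω y := fun y => sub_pos.2 (sinh_mul_lt_cosh r (hωI y))
  have hs := sinh_pos_iff.2 hr
  have hMc : ContinuousOn (mobiusShift r) (Icc (-1) 1) := fun w hw =>
    (hasDerivAt_mobiusShift r hw).continuousAt.continuousWithinAt
  have hMω : Continuous fun y => mobiusShift r (ω y) := hMc.comp_continuous hωc hωI
  have hkω : Continuous fun y => hypDensity m r (ω y) :=
    (continuousOn_hypDensity m r).comp_continuous hωc hωI
  have hk0 : ∀ y, 0 < hypDensity m r (ω y) := fun y => hypDensity_pos m hr (hω y).1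
  have hMγ : Integrable fun y => mobiusShift r (ω y) * γ y :=
    (hMω.mul hγc).integrable_of_hasCompactSupport hγs.mul_left
  have hsl := le_integral_gradNorm_mul hm (gagliardoNirenberg hm) hv hvs hv0 isOpen_Ioi hvO
    (p := fun y => (y ^ m)⁻¹) (p' := fun y => -m * (y ^ (m + 1))⁻¹)
    (T := fun y => mobiusShift r (ω y))
    (T' := fun y => 1 / (cosh r - sinh r * ω y) ^ 2 * (γ y / hypDensity m r (ω y)))
    (g := fun y => (cosh r / sinh r + mobiusShift r (ω y)) * γ y)
    (fun y hy => by
      have hy0 : y ≠ 0 := (mem_Ioi.1 hy).ne'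
      refine ((hasDerivAt_pow m y).inv (pow_ne_zero m hy0)).congr_deriv ?_
      obtain ⟨k, rfl⟩ : ∃ k, m = k + 1 := ⟨m - 1, by lia⟩
      simp only [add_tsub_cancel_right]
      field_simp
      ring)
    (fun y _ => (hasDerivAt_mobiusShift r (hωI y)).comp y (hω y).2)
    (continuousOn_const.mul (hpc _))
    ((continuous_const.div (by fun_prop) fun y => (pow_pos (hD y) 2).ne').mul
      (hγc.div hkω fun y => (hk0 y).ne')).continuousOn
    (fun y hy => inv_pos.2 (pow_pos hy m)) (fun y _ => abs_mobiusShift_le_one r (hωI y))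
    (fun y _ => mul_nonneg (one_div_nonneg.2 (sq_nonneg _)) (div_nonneg (hγ0 y) (hk0 y).le))
    (((continuous_const.add hMω).mul hγc).integrable_of_hasCompactSupport hγs.mul_left)
    (fun y hy => by simp [hγO y hy])
    fun y hy => by
      have hy0 : 0 < y := hy
      have hDy := hD y
      have hσ := unitBallVol_pos m
      have hρ : 0 < √(1 - ω y ^ 2) := sqrt_pos.2 (by nlinarith [(hω y).1.1, (hω y).1.2])
      rw [coth_add_mobiusShift hr (hωI y), one_sub_mobiusShift_sq r (hωI y),
        sqrt_div (by nlinarith [(hωI y).1, (hωI y).2]), sqrt_sq hDy.le]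
      have hGγ : ∫ x, v (x, y) ^ a = γ y * y ^ (m + 1) := by
        simp only [hγdef, integral_mul_const]
        field_simp
      rw [hGγ]
      unfold hypDensity
      have e : (γ y * y ^ (m + 1)) ^ m = γ y ^ m * (y ^ m) ^ (m + 1) := by ring
      have hY : y ^ m ≠ 0 := (pow_pos hy0 m).ne'
      rw [e]
      generalize y ^ m = Y at hY
      generalize cosh r - sinh r * ω y = D at hDy
      generalize √(1 - ω y ^ 2) = ρ at hρ
      apply le_of_eq
      simp only [mul_pow, div_pow, inv_pow, one_pow]
      field_simp
      ring
  have hA : ∫ z, v z * (-m * (z.2 ^ (m + 1))⁻¹ * mobiusShift r (ω z.2)) =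
      -m * (∫ z, (v z - v z ^ a) * (z.2 ^ (m + 1))⁻¹ * mobiusShift r (ω z.2)) -
        m * ∫ y, mobiusShift r (ω y) * γ y := by
    have e1 : ∫ y, mobiusShift r (ω y) * γ y =
        ∫ z, v z ^ a * (z.2 ^ (m + 1))⁻¹ * mobiusShift r (ω z.2) := by
      rw [Measure.volume_eq_prod, integral_prod_symm]
      · simp only [integral_mul_const, hγdef]
        simp only [mul_comm]
      · exact (hfc.mul (hMω.comp continuous_snd)).integrable_of_hasCompactSupport hfs.mul_right
    rw [e1, ← integral_const_mul, ← integral_const_mul, ← integral_sub]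
    · congr 1
      ext z
      ring
    · refine Integrable.const_mul ?_ _
      simp only [sub_mul]
      exact ((hvpc.mul (hMω.comp continuous_snd)).integrable_of_hasCompactSupport
        hvps.mul_right).sub
        ((hfc.mul (hMω.comp continuous_snd)).integrable_of_hasCompactSupport hfs.mul_right)
    · refine Integrable.const_mul ?_ _
      exact (hfc.mul (hMω.comp continuous_snd)).integrable_of_hasCompactSupport hfs.mul_right
  have hB : ∫ z, (v z - v z ^ a) * (z.2 ^ (m + 1))⁻¹ * mobiusShift r (ω z.2) ≤
      ∫ z, (v z - v z ^ a) * (z.2 ^ (m + 1))⁻¹ := by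
    refine integral_mono ?_ ?_ fun z => ?_
    · simp only [sub_mul]
      exact ((hvpc.mul (hMω.comp continuous_snd)).integrable_of_hasCompactSupport
        hvps.mul_right).sub
        ((hfc.mul (hMω.comp continuous_snd)).integrable_of_hasCompactSupport hfs.mul_right)
    · simp only [sub_mul]
      exact (hvpc.integrable_of_hasCompactSupport hvps).sub
        (hfc.integrable_of_hasCompactSupport hfs)
    · have h1 := (abs_le.1 (abs_mobiusShift_le_one r (hωI z.2))).2
      have h2 : v z ^ a ≤ v z := by
        simpa using rpow_le_rpow_of_exponent_ge' (hv0 z) (hv1 z) zero_le_one ha1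
      refine mul_le_of_le_one_right ?_ h1
      by_cases hz : z ∈ tsupport v
      · have := hvO z hz
        exact mul_nonneg (sub_nonneg.2 h2) (by positivity)
      · simp [image_eq_zero_of_notMem_tsupport hz, zero_rpow ha0.ne']
  have hE := integral_mobiusShift_mul_ge (m := m) hr hγc hγ0 hγs hω
  have hF : ∫ y, (cosh r / sinh r + mobiusShift r (ω y)) * γ y =
      cosh r / sinh r * (∫ y, γ y) + ∫ y, mobiusShift r (ω y) * γ y := by
    rw [← integral_const_mul, ← integral_add (hγi.const_mul _) hMγ]
    congr 1
    ext y
    ring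
  rw [hA, hF] at hsl
  have := mul_le_mul_of_nonneg_left hB hm'.le
  linarith

/-- The isoperimetric lower bound for a single function with values in `[0, 1]`. -/
theorem pow_add_pow_le_of_le_one {m : ℕ} (hm : 0 < m)
    {v : EuclideanSpace ℝ (Fin m) × ℝ → ℝ} (hv : ContDiff ℝ 1 v) (hvs : HasCompactSupport v)
    (hvO : ∀ z ∈ tsupport v, 0 < z.2) (hv0 : ∀ z, 0 ≤ v z) (hv1 : ∀ z, v z ≤ 1) {C : ℝ}
    (hC : C = ∫ z, v z ^ (((m : ℝ) + 1) / m) * (z.2 ^ (m + 1))⁻¹) :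
    (m : ℝ) ^ (m + 1) * C ^ (m + 1) + ((m : ℝ) + 1) ^ (m + 1) * unitBallVol (m + 1) * C ^ m ≤
      ((∫ z, gradNorm v z * (z.2 ^ m)⁻¹) +
        m * ∫ z, (v z - v z ^ (((m : ℝ) + 1) / m)) * (z.2 ^ (m + 1))⁻¹) ^ (m + 1) := by
  have hm' : (0 : ℝ) < m := by exact_mod_cast hm
  have ha0 : 0 < ((m : ℝ) + 1) / m := by positivity
  have ha1 : 1 ≤ ((m : ℝ) + 1) / m := by rw [one_le_div hm']; linarith
  have hout : ∀ z ∉ tsupport v, v z = 0 := fun z hz => image_eq_zero_of_notMem_tsupport hz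
  have hC0 : 0 ≤ C := by
    rw [hC]
    refine integral_nonneg fun z => ?_
    by_cases hz : z ∈ tsupport v
    · have := hvO z hz
      have := hv0 z
      simp only [Pi.zero_apply]
      positivity
    · simp [hout z hz, zero_rpow ha0.ne']
  rcases hC0.eq_or_lt with h0 | h0
  · rw [← h0, zero_pow hm.ne', zero_pow (by lia), mul_zero, mul_zero, add_zero]
    refine pow_nonneg (add_nonneg ?_ (mul_nonneg hm'.le ?_)) _
    · refine integral_nonneg fun z => ?_
      by_cases hz : z ∈ tsupport v
      · have := hvO z hz
        exact mul_nonneg (gradNorm_nonneg v z) (by positivity)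
      · have : gradNorm v z = 0 :=
          image_eq_zero_of_notMem_tsupport fun h => hz (tsupport_gradNorm_subset v h)
        simp [this]
    · refine integral_nonneg fun z => ?_
      by_cases hz : z ∈ tsupport v
      · have := hvO z hz
        have h2 : v z ^ (((m : ℝ) + 1) / m) ≤ v z := by
          simpa using rpow_le_rpow_of_exponent_ge' (hv0 z) (hv1 z) zero_le_one ha1
        exact mul_nonneg (sub_nonneg.2 h2) (by positivity)
      · simp [hout z hz, zero_rpow ha0.ne']
  set P := (∫ z, gradNorm v z * (z.2 ^ m)⁻¹) +
        m * ∫ z, (v z - v z ^ (((m : ℝ) + 1) / m)) * (z.2 ^ (m + 1))⁻¹ with hP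
  have hσ := unitBallVol_pos (m + 1)
  set N : ℝ := (m + 1) * unitBallVol (m + 1) with hN
  have hN0 : 0 < N := by positivity
  obtain ⟨r₀, hr₀, hrC⟩ := exists_sinhPowInt_eq m (div_pos h0 hN0)
  have hs := sinh_pos_iff.2 hr₀
  have hlim : N * sinh r₀ ^ m ≤ P := by
    have hcont : ContinuousAt (fun r => N * sinh r ^ m -
        ((m + 1) * (cosh r / sinh r) + 1) * (N * sinhPowInt m r - C)) r₀ := by
      have h1 : ContinuousAt (sinhPowInt m) r₀ := (hasDerivAt_sinhPowInt m r₀).continuousAt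
      have h2 : ContinuousAt (fun r => cosh r / sinh r) r₀ :=
        continuous_cosh.continuousAt.div continuous_sinh.continuousAt hs.ne'
      have h3 : ContinuousAt sinh r₀ := continuous_sinh.continuousAt
      fun_prop
    have ht := (hcont.tendsto).mono_left (nhdsWithin_le_nhds (s := Ioi r₀))
    have e : N * sinhPowInt m r₀ - C = 0 := by rw [hrC]; field_simp; ring
    rw [e, mul_zero, sub_zero] at ht
    refine le_of_tendsto ht ?_
    filter_upwards [self_mem_nhdsWithin] with r hr
    have hr0 : 0 < r := hr₀.trans hr
    have hlt : C < N * sinhPowInt m r := by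
      have := strictMonoOn_sinhPowInt m (mem_Ici.2 hr₀.le) (mem_Ici.2 hr0.le) hr
      rw [hrC, div_lt_iff₀ hN0] at this
      linarith
    rw [hC] at hlt ⊢
    exact le_integral_gradNorm_mul_of_lt hm hv hvs hvO hv0 hv1 hr0 hlt
  refine le_trans ?_ (pow_le_pow_left₀ (by positivity) hlim (m + 1))
  obtain ⟨k, rfl⟩ : ∃ k, m = k + 1 := ⟨m - 1, by lia⟩
  have hk := sinhPowInt_pow_le_sinh_pow k hr₀.le
  rw [hrC] at hk
  have h2 := mul_le_mul_of_nonneg_left hk (pow_nonneg hN0.le (k + 2))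
  rw [mul_pow, ← pow_mul]
  refine le_trans (le_of_eq ?_) h2
  rw [mul_add, div_pow, div_pow]
  have e1 : N ^ (k + 2) * (((k : ℝ) + 1) ^ (k + 2) * (C ^ (k + 2) / N ^ (k + 2))) =
      ((k : ℝ) + 1) ^ (k + 2) * C ^ (k + 2) := by field_simp
  have e2 : N ^ (k + 2) * (((k : ℝ) + 2) ^ (k + 1) * (C ^ (k + 1) / N ^ (k + 1))) =
      N * (((k : ℝ) + 2) ^ (k + 1) * C ^ (k + 1)) := by field_simp; ring
  rw [e1, e2, hN]
  push_cast
  ring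

section LayerCake

variable {X : Type*} [MeasurableSpace X] {ν : Measure X} [IsFiniteMeasure ν]

theorem integral_mul_eq_integral_setIntegral_lt {f g : X → ℝ} {M K : ℝ} (hf : Measurable f)
    (hf0 : ∀ x, 0 ≤ f x) (hfM : ∀ x, f x ≤ M) (hg : Measurable g) (hgK : ∀ x, |g x| ≤ K) :
    ∫ x, f x * g x ∂ν = ∫ t in (0 : ℝ)..M, ∫ x in {x | t < f x}, g x ∂ν := by
  rcases isEmpty_or_nonempty X with hX | ⟨⟨x₀⟩⟩
  · simp [Measure.eq_zero_of_isEmpty]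
  have hM : 0 ≤ M := (hf0 x₀).trans (hfM x₀)
  have hms : MeasurableSet {q : X × ℝ | q.2 < f q.1} :=
    measurableSet_lt measurable_snd (hf.comp measurable_fst)
  have hint : Integrable (Function.uncurry fun (x : X) (t : ℝ) =>
      {q : X × ℝ | q.2 < f q.1}.indicator (fun q => g q.1) (x, t))
      (ν.prod (volume.restrict (Ioc 0 M))) := by
    refine Integrable.of_bound
      ((hg.comp measurable_fst).indicator hms).aestronglyMeasurable K
      (Eventually.of_forall fun q => ?_)
    refine (norm_indicator_le_norm_self (fun q : X × ℝ => g q.1) q).trans ?_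
    exact hgK q.1
  have h := integral_integral_swap hint
  rw [intervalIntegral.integral_of_le hM]
  calc ∫ x, f x * g x ∂ν = ∫ x, (∫ t in Ioc (0 : ℝ) M,
        {q : X × ℝ | q.2 < f q.1}.indicator (fun q => g q.1) (x, t)) ∂ν := by
        refine integral_congr_ae (Eventually.of_forall fun x => ?_)
        have e : ∀ t, {q : X × ℝ | q.2 < f q.1}.indicator (fun q => g q.1) (x, t) =
            (Iio (f x)).indicator (fun _ => g x) t := fun t => rfl
        simp only [e]
        rw [setIntegral_indicator measurableSet_Iio, setIntegral_const]
        have e2 : volume.real (Ioc 0 M ∩ Iio (f x)) = f x := by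
          have h1 : volume (Ioc 0 M ∩ Iio (f x)) = volume (Ioo 0 (f x)) := by
            refine le_antisymm (measure_mono ?_) (measure_mono ?_)
            · rintro t ⟨h1, h2⟩
              exact ⟨h1.1, h2⟩
            · rintro t ⟨h1, h2⟩
              exact ⟨⟨h1, h2.le.trans (hfM x)⟩, h2⟩
          rw [measureReal_def, h1, Real.volume_Ioo, sub_zero, ENNReal.toReal_ofReal (hf0 x)]
        rw [e2, smul_eq_mul]
    _ = ∫ t in Ioc (0 : ℝ) M, (∫ x,
        {q : X × ℝ | q.2 < f q.1}.indicator (fun q => g q.1) (x, t) ∂ν) := h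
    _ = _ := by
        refine integral_congr_ae (Eventually.of_forall fun t => ?_)
        exact integral_indicator (f := g) (measurableSet_lt measurable_const hf)

theorem integral_eq_integral_measureReal_lt {f : X → ℝ} {M : ℝ} (hf : Measurable f)
    (hf0 : ∀ x, 0 ≤ f x) (hfM : ∀ x, f x ≤ M) :
    ∫ x, f x ∂ν = ∫ t in (0 : ℝ)..M, ν.real {x | t < f x} := by
  have := integral_mul_eq_integral_setIntegral_lt (ν := ν) (g := fun _ => 1) (K := 1) hf hf0 hfM
    measurable_const (by simp)
  simpa using this

theorem antitone_measureReal_lt (f : X → ℝ) : Antitone fun t => ν.real {x | t < f x} :=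
  fun _ _ h => measureReal_mono fun _ hx => h.trans_lt hx

theorem rpow_integral_le_integral_rpow {f : X → ℝ} {M : ℝ} {m : ℕ} (hm : 0 < m)
    (hf : Measurable f) (hf0 : ∀ x, 0 ≤ f x) (hM : 0 ≤ M) (hfM : ∀ x, f x ≤ M) :
    (∫ x, f x ^ (((m : ℝ) + 1) / m) ∂ν) ^ ((m : ℝ) / (m + 1)) ≤
      ∫ t in (0 : ℝ)..M, ν.real {x | t < f x} ^ ((m : ℝ) / (m + 1)) := by
  have hm' : (0 : ℝ) < m := by exact_mod_cast hm
  set n : ℝ := (m : ℝ) + 1 with hn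
  have hn0 : 0 < n := by positivity
  set X₀ := ∫ x, f x ^ (n / m) ∂ν with hX
  have hX0 : 0 ≤ X₀ := integral_nonneg fun x => rpow_nonneg (hf0 x) _
  have hanti : Antitone fun t => ν.real {x | t < f x} ^ ((m : ℝ) / n) := fun s t h =>
    rpow_le_rpow measureReal_nonneg (antitone_measureReal_lt f h) (by positivity)
  have hR0 : 0 ≤ ∫ t in (0 : ℝ)..M, ν.real {x | t < f x} ^ ((m : ℝ) / n) :=
    intervalIntegral.integral_nonneg hM fun t _ => rpow_nonneg measureReal_nonneg _
  rcases hX0.eq_or_lt with h0 | h0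
  · rw [← h0, zero_rpow (by positivity)]
    exact hR0
  have hgm : Measurable fun x => f x ^ (1 / (m : ℝ)) := hf.pow_const _
  have hgb : ∀ x, |f x ^ (1 / (m : ℝ))| ≤ M ^ (1 / (m : ℝ)) := fun x => by
    rw [abs_of_nonneg (rpow_nonneg (hf0 x) _)]
    exact rpow_le_rpow (hf0 x) (hfM x) (by positivity)
  have h1 := integral_mul_eq_integral_setIntegral_lt (ν := ν) hf hf0 hfM hgm hgb
  have e1 : ∀ x, f x * f x ^ (1 / (m : ℝ)) = f x ^ (n / m) := by
    intro x
    rw [hn, add_div, div_self hm'.ne', rpow_add_of_nonneg (hf0 x) zero_le_one (by positivity),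
      rpow_one]
  simp only [e1] at h1
  rw [← hX] at h1
  have hpq : (n / m).HolderConjugate n := by
    have := Real.HolderConjugate.conjExponent (p := n) (by linarith)
    have h2 : n.HolderConjugate (n / m) := by simpa [Real.conjExponent, hn] using this
    exact h2.symm
  have hho : ∀ t, ∫ x in {x | t < f x}, f x ^ (1 / (m : ℝ)) ∂ν ≤
      ν.real {x | t < f x} ^ ((m : ℝ) / n) * X₀ ^ (1 / n) := by
    intro t
    have hms : MeasurableSet {x | t < f x} := measurableSet_lt measurable_const hf
    have h := integral_mul_le_Lp_mul_Lq_of_nonneg (μ := ν) hpq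
      (f := {x | t < f x}.indicator fun _ => 1) (g := fun x => f x ^ (1 / (m : ℝ)))
      (Eventually.of_forall fun x => indicator_nonneg (fun _ _ => zero_le_one) x)
      (Eventually.of_forall fun x => rpow_nonneg (hf0 x) _)
      (MemLp.of_bound (measurable_const.indicator hms).aestronglyMeasurable 1
        (Eventually.of_forall fun x => (norm_indicator_le_norm_self _ x).trans (by simp)))
      (MemLp.of_bound hgm.aestronglyMeasurable _ (Eventually.of_forall hgb))
    have e2 : ∀ x, {x | t < f x}.indicator (fun _ => (1 : ℝ)) x * f x ^ (1 / (m : ℝ)) =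
        {x | t < f x}.indicator (fun x => f x ^ (1 / (m : ℝ))) x := by
      intro x
      by_cases hx : x ∈ {x | t < f x} <;> simp [hx]
    have e3 : ∀ x, {x | t < f x}.indicator (fun _ => (1 : ℝ)) x ^ (n / m) =
        {x | t < f x}.indicator (fun _ => (1 : ℝ)) x := by
      intro x
      have : n / m ≠ 0 := by positivity
      by_cases hx : x ∈ {x | t < f x} <;> simp [hx, zero_rpow this]
    have e4 : ∀ x, (f x ^ (1 / (m : ℝ))) ^ n = f x ^ (n / m) := by
      intro x
      rw [← rpow_mul (hf0 x)]
      congr 1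
      ring
    simp only [e2, e3, e4] at h
    rw [integral_indicator hms, integral_indicator hms, setIntegral_const, smul_eq_mul, mul_one,
      one_div_div] at h
    exact h
  have h2 : X₀ ≤ (∫ t in (0 : ℝ)..M, ν.real {x | t < f x} ^ ((m : ℝ) / n)) * X₀ ^ (1 / n) := by
    rw [← intervalIntegral.integral_mul_const]
    conv_lhs => rw [h1]
    refine intervalIntegral.integral_mono_on hM ?_ (hanti.intervalIntegrable.mul_const _)
      fun t _ => hho t
    refine Antitone.intervalIntegrable fun s t h => ?_
    refine setIntegral_mono_set (Integrable.of_bound hgm.aestronglyMeasurable _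
      (Eventually.of_forall hgb)).integrableOn
      (Eventually.of_forall fun x => rpow_nonneg (hf0 x) _)
      (Eventually.of_forall fun x (hx : t < f x) => lt_of_le_of_lt h hx)
  have h3 : X₀ = X₀ ^ ((m : ℝ) / n) * X₀ ^ (1 / n) := by
    rw [← rpow_add h0, ← add_div, ← hn, div_self hn0.ne', rpow_one]
  rw [h3] at h2
  have h4 := rpow_pos_of_pos h0 (1 / n)
  rw [← h3] at h2
  refine le_of_mul_le_mul_right ?_ h4
  rwa [← h3]

/-- From the isoperimetric profile along the level sets to the functional inequality. -/
theorem pow_add_pow_le_of_integral_level_le {f : X → ℝ} {M P σ : ℝ} {m : ℕ} (hm : 0 < m)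
    (hσ : 0 ≤ σ) (hf : Measurable f) (hf0 : ∀ x, 0 ≤ f x) (hM : 0 ≤ M) (hfM : ∀ x, f x ≤ M)
    (hP : ∫ t in (0 : ℝ)..M, ((m : ℝ) ^ (m + 1) * ν.real {x | t < f x} ^ (m + 1) +
      ((m : ℝ) + 1) ^ (m + 1) * σ * ν.real {x | t < f x} ^ m) ^ (1 / ((m : ℝ) + 1)) ≤ P) :
    (m : ℝ) ^ (m + 1) * (∫ x, f x ∂ν) ^ (m + 1) + ((m : ℝ) + 1) ^ (m + 1) * σ *
      (∫ x, f x ^ (((m : ℝ) + 1) / m) ∂ν) ^ m ≤ P ^ (m + 1) := by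
  have hm' : (0 : ℝ) < m := by exact_mod_cast hm
  set n : ℝ := (m : ℝ) + 1 with hn
  have hn0 : 0 < n := by positivity
  set D : ℝ → ℝ := fun t => ν.real {x | t < f x} with hD
  have hD0 : ∀ t, 0 ≤ D t := fun t => measureReal_nonneg
  have hDa : Antitone D := antitone_measureReal_lt f
  set c : ℝ := n * σ ^ (1 / n) with hc
  have hc0 : 0 ≤ c := by positivity
  have hnat : ((m + 1 : ℕ) : ℝ) = n := by push_cast; rfl
  have hcp : c ^ (m + 1) = n ^ (m + 1) * σ := by
    rw [hc, mul_pow, ← rpow_mul_natCast hσ, hnat, one_div_mul_cancel hn0.ne', rpow_one]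
  have hpw : ∀ {x : ℝ}, 0 ≤ x → (x ^ ((m : ℝ) / n)) ^ (m + 1) = x ^ m := by
    intro x hx
    rw [← rpow_mul_natCast hx, hnat, div_mul_cancel₀ _ hn0.ne', rpow_natCast]
  set A : ℝ := m * ∫ x, f x ∂ν with hA
  set J : ℝ := (∫ x, f x ^ (n / m) ∂ν) ^ ((m : ℝ) / n) with hJ
  have hI0 : 0 ≤ ∫ x, f x ^ (n / m) ∂ν := integral_nonneg fun x => rpow_nonneg (hf0 x) _
  have hA0 : 0 ≤ A := mul_nonneg hm'.le (integral_nonneg hf0)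
  have hJ0 : 0 ≤ J := rpow_nonneg hI0 _
  have hgoal : (m : ℝ) ^ (m + 1) * (∫ x, f x ∂ν) ^ (m + 1) + n ^ (m + 1) * σ *
      (∫ x, f x ^ (n / m) ∂ν) ^ m = A ^ (m + 1) + (c * J) ^ (m + 1) := by
    rw [mul_pow, mul_pow, hcp, hJ, hpw hI0]
  rw [hgoal]
  set N := A ^ (m + 1) + (c * J) ^ (m + 1) with hN
  have hN0 : 0 ≤ N := by positivity
  have hpq : n.HolderConjugate (n / m) := by
    have := Real.HolderConjugate.conjExponent (p := n) (by linarith)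
    simpa [Real.conjExponent, hn] using this
  have hpm : ∀ {x : ℝ}, 0 ≤ x → (x ^ m) ^ (n / m) = x ^ (m + 1) := by
    intro x hx
    rw [← rpow_natCast x m, ← rpow_mul hx, mul_div_cancel₀ _ hm'.ne', ← hnat, rpow_natCast]
  have hpn : ∀ x : ℝ, x ^ n = x ^ (m + 1) := fun x => by rw [← hnat, rpow_natCast]
  have hpt : ∀ t, m * D t * A ^ m + c * D t ^ ((m : ℝ) / n) * (c * J) ^ m ≤
      ((m : ℝ) ^ (m + 1) * D t ^ (m + 1) + n ^ (m + 1) * σ * D t ^ m) ^ (1 / n) *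
        N ^ ((m : ℝ) / n) := by
    intro t
    have h := Real.inner_le_Lp_mul_Lq_of_nonneg (Finset.univ : Finset (Fin 2)) hpq
      (f := ![m * D t, c * D t ^ ((m : ℝ) / n)]) (g := ![A ^ m, (c * J) ^ m])
      (by
        intro i _
        have := hD0 t
        fin_cases i
        · simp; positivity
        · simp; positivity)
      (by
        intro i _
        fin_cases i
        · simp; positivity
        · simp; positivity)
    simp only [Fin.sum_univ_two, Matrix.cons_val_zero, Matrix.cons_val_one, hpn, hpm hA0,
      hpm (mul_nonneg hc0 hJ0), mul_pow (m : ℝ) (D t), mul_pow c (D t ^ ((m : ℝ) / n)),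
      hpw (hD0 t), hcp, one_div_div] at h
    exact h
  have hint1 : IntervalIntegrable (fun t => m * D t * A ^ m) volume 0 M :=
    (hDa.intervalIntegrable.const_mul _).mul_const _
  have hDr : Antitone fun t => D t ^ ((m : ℝ) / n) := fun s t h =>
    rpow_le_rpow (hD0 t) (hDa h) (by positivity)
  have hint2 : IntervalIntegrable (fun t => c * D t ^ ((m : ℝ) / n) * (c * J) ^ m) volume 0 M :=
    (hDr.intervalIntegrable.const_mul _).mul_const _
  have hψ : Antitone fun t =>
      ((m : ℝ) ^ (m + 1) * D t ^ (m + 1) + n ^ (m + 1) * σ * D t ^ m) ^ (1 / n) := by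
    intro s t h
    have h1 := hD0 t
    have h2 := hD0 s
    have h3 := hDa h
    refine rpow_le_rpow (by positivity) ?_ (by positivity)
    gcongr
  have hkey := intervalIntegral.integral_mono_on hM (hint1.add hint2)
    (hψ.intervalIntegrable.mul_const (N ^ ((m : ℝ) / n))) fun t _ => hpt t
  rw [intervalIntegral.integral_add hint1 hint2, intervalIntegral.integral_mul_const,
    intervalIntegral.integral_mul_const, intervalIntegral.integral_mul_const,
    intervalIntegral.integral_const_mul, intervalIntegral.integral_const_mul,
    ← integral_eq_integral_measureReal_lt hf hf0 hfM] at hkey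
  have hJle : J ≤ ∫ t in (0 : ℝ)..M, D t ^ ((m : ℝ) / n) :=
    rpow_integral_le_integral_rpow hm hf hf0 hM hfM
  have hfin : N ≤ P * N ^ ((m : ℝ) / n) := by
    calc N = A * A ^ m + c * J * (c * J) ^ m := by rw [hN]; ring
      _ ≤ A * A ^ m + c * (∫ t in (0 : ℝ)..M, D t ^ ((m : ℝ) / n)) * (c * J) ^ m := by gcongr
      _ ≤ _ := hkey
      _ ≤ _ := by gcongr
  have hP0 : 0 ≤ P := le_trans (intervalIntegral.integral_nonneg hM fun t _ => by
    have := hD0 t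
    positivity) hP
  rcases hN0.eq_or_lt with h0 | h0
  · rw [← h0]; positivity
  have h3 : N = N ^ (1 / n) * N ^ ((m : ℝ) / n) := by
    rw [← rpow_add h0, ← add_div, add_comm, ← hn, div_self hn0.ne', rpow_one]
  have h4 : N ^ (1 / n) ≤ P := by
    refine le_of_mul_le_mul_right ?_ (rpow_pos_of_pos h0 ((m : ℝ) / n))
    rwa [← h3]
  have h5 := pow_le_pow_left₀ (rpow_nonneg hN0 _) h4 (m + 1)
  rwa [← rpow_mul_natCast hN0, hnat, one_div_mul_cancel hn0.ne', rpow_one] at h5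

end LayerCake

section LevelCutoff

/-- A smooth even cutoff vanishing for `|x| ≤ t` and equal to `1` for `t + ε ≤ |x|`. -/
noncomputable def levelCutoff (ε t x : ℝ) : ℝ :=
  smoothTransition ((x - t) / ε) + smoothTransition ((-x - t) / ε)

/-- A bound for the slope of `levelCutoff`. -/
noncomputable def levelSlope (ε t x : ℝ) : ℝ :=
  (deriv smoothTransition ((x - t) / ε) + deriv smoothTransition ((-x - t) / ε)) / ε

theorem deriv_smoothTransition_nonneg (x : ℝ) : 0 ≤ deriv smoothTransition x :=
  smoothTransition.monotone.deriv_nonneg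

theorem continuous_deriv_smoothTransition : Continuous (deriv smoothTransition) :=
  (smoothTransition.contDiff (n := 1)).continuous_deriv le_rfl

theorem hasDerivAt_smoothTransition (x : ℝ) :
    HasDerivAt smoothTransition (deriv smoothTransition x) x :=
  ((smoothTransition.contDiff (n := 1)).differentiable one_ne_zero x).hasDerivAt

theorem exists_deriv_smoothTransition_le : ∃ K, ∀ x, deriv smoothTransition x ≤ K := by
  have hcs : HasCompactSupport (deriv smoothTransition) := by
    refine HasCompactSupport.intro (isCompact_Icc (a := (0 : ℝ)) (b := 1)) fun x hx => ?_
    rw [mem_Icc, not_and_or, not_le, not_le] at hx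
    rcases hx with hx | hx
    · have : smoothTransition =ᶠ[𝓝 x] fun _ => 0 :=
        (eventually_lt_nhds hx).mono fun y hy => smoothTransition.zero_of_nonpos hy.le
      rw [this.deriv_eq, deriv_const]
    · have : smoothTransition =ᶠ[𝓝 x] fun _ => 1 :=
        (eventually_gt_nhds hx).mono fun y hy => smoothTransition.one_of_one_le hy.le
      rw [this.deriv_eq, deriv_const]
  obtain ⟨K, hK⟩ := continuous_deriv_smoothTransition.bounded_above_of_compact_support hcs
  exact ⟨K, fun x => (le_abs_self _).trans (hK x)⟩

theorem contDiff_levelCutoff (ε t : ℝ) : ContDiff ℝ 1 (levelCutoff ε t) := by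
  have h := smoothTransition.contDiff (n := 1)
  exact (h.comp ((contDiff_id.sub contDiff_const).div_const ε)).add
    (h.comp ((contDiff_id.neg.sub contDiff_const).div_const ε))

theorem levelSlope_nonneg {ε : ℝ} (hε : 0 < ε) (t x : ℝ) : 0 ≤ levelSlope ε t x :=
  div_nonneg (add_nonneg (deriv_smoothTransition_nonneg _) (deriv_smoothTransition_nonneg _)) hε.le

theorem abs_deriv_levelCutoff_le {ε : ℝ} (hε : 0 < ε) (t x : ℝ) :
    |deriv (levelCutoff ε t) x| ≤ levelSlope ε t x := by
  have h1 := (hasDerivAt_smoothTransition ((x - t) / ε)).comp x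
    (((hasDerivAt_id x).sub_const t).div_const ε)
  have h2 := (hasDerivAt_smoothTransition ((-x - t) / ε)).comp x
    (((hasDerivAt_id x).neg.sub_const t).div_const ε)
  have h3 : HasDerivAt (levelCutoff ε t) _ x := h1.add h2
  rw [h3.deriv, levelSlope]
  have a := deriv_smoothTransition_nonneg ((x - t) / ε)
  have b := deriv_smoothTransition_nonneg ((-x - t) / ε)
  have e : deriv smoothTransition ((x - t) / ε) * (1 / ε) +
      deriv smoothTransition ((-x - t) / ε) * (-1 / ε) =
      (deriv smoothTransition ((x - t) / ε) - deriv smoothTransition ((-x - t) / ε)) / ε := by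
    ring
  rw [e, abs_div, abs_of_pos hε]
  gcongr
  rw [abs_le]
  constructor <;> linarith

theorem levelCutoff_eq_zero {ε t x : ℝ} (hε : 0 < ε) (hx : |x| ≤ t) : levelCutoff ε t x = 0 := by
  have h := abs_le.1 hx
  rw [levelCutoff, smoothTransition.zero_of_nonpos (div_nonpos_of_nonpos_of_nonneg _ hε.le),
    smoothTransition.zero_of_nonpos (div_nonpos_of_nonpos_of_nonneg _ hε.le), add_zero] <;> linarith

theorem levelCutoff_eq_one {ε t x : ℝ} (hε : 0 < ε) (ht : 0 ≤ t) (hx : t + ε ≤ |x|) :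
    levelCutoff ε t x = 1 := by
  rcases le_abs.1 hx with h | h
  · rw [levelCutoff, smoothTransition.one_of_one_le ((one_le_div hε).2 (by linarith)),
      smoothTransition.zero_of_nonpos (div_nonpos_of_nonpos_of_nonneg (by linarith) hε.le),
      add_zero]
  · rw [levelCutoff, smoothTransition.zero_of_nonpos
      (div_nonpos_of_nonpos_of_nonneg (by linarith) hε.le),
      smoothTransition.one_of_one_le ((one_le_div hε).2 (by linarith)), zero_add]

theorem levelCutoff_nonneg (ε t x : ℝ) : 0 ≤ levelCutoff ε t x :=
  add_nonneg (smoothTransition.nonneg _) (smoothTransition.nonneg _)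

theorem levelCutoff_le_one {ε t : ℝ} (hε : 0 < ε) (ht : 0 ≤ t) (x : ℝ) :
    levelCutoff ε t x ≤ 1 := by
  have a := smoothTransition.le_one ((x - t) / ε)
  have b := smoothTransition.le_one ((-x - t) / ε)
  rcases le_total 0 x with h | h
  · rw [levelCutoff, smoothTransition.zero_of_nonpos (x := (-x - t) / ε)
      (div_nonpos_of_nonpos_of_nonneg (by linarith) hε.le)]
    linarith
  · rw [levelCutoff, smoothTransition.zero_of_nonpos (x := (x - t) / ε)
      (div_nonpos_of_nonpos_of_nonneg (by linarith) hε.le)]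
    linarith

theorem continuous_levelSlope (ε : ℝ) : Continuous fun q : ℝ × ℝ => levelSlope ε q.1 q.2 := by
  have h := continuous_deriv_smoothTransition
  unfold levelSlope
  fun_prop

theorem exists_levelSlope_le {ε : ℝ} (hε : 0 < ε) : ∃ K, ∀ t x, levelSlope ε t x ≤ K := by
  obtain ⟨K, hK⟩ := exists_deriv_smoothTransition_le
  refine ⟨(K + K) / ε, fun t x => ?_⟩
  unfold levelSlope
  gcongr <;> exact hK _

theorem integral_levelSlope_le_one {ε : ℝ} (hε : 0 < ε) (M x : ℝ) :
    ∫ t in (0 : ℝ)..M, levelSlope ε t x ≤ 1 := by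
  have hd : ∀ t, HasDerivAt (fun t => -levelCutoff ε t x) (levelSlope ε t x) t := by
    intro t
    have h1 := (hasDerivAt_smoothTransition ((x - t) / ε)).comp t
      (((hasDerivAt_id t).const_sub x).div_const ε)
    have h2 := (hasDerivAt_smoothTransition ((-x - t) / ε)).comp t
      (((hasDerivAt_id t).const_sub (-x)).div_const ε)
    refine HasDerivAt.congr_deriv (h1.add h2).neg ?_
    rw [levelSlope]
    ring
  rw [intervalIntegral.integral_eq_sub_of_hasDerivAt (fun t _ => hd t)
    ((continuous_levelSlope ε).comp (by fun_prop : Continuous fun t : ℝ => (t, x))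
      |>.intervalIntegrable _ _)]
  have a := levelCutoff_nonneg ε M x
  have b := levelCutoff_le_one hε le_rfl x
  linarith

theorem gradNorm_levelCutoff_comp_le {E : Type*} [NormedAddCommGroup E] [NormedSpace ℝ E]
    {U : E × ℝ → ℝ} (hU : ContDiff ℝ 1 U) {ε : ℝ} (hε : 0 < ε) (t : ℝ) (z : E × ℝ) :
    gradNorm (fun z => levelCutoff ε t (U z)) z ≤ levelSlope ε t (U z) * gradNorm U z := by
  have h1 := ((contDiff_levelCutoff ε t).differentiable one_ne_zero (U z)).hasDerivAt
  have h2 := h1.comp_hasFDerivAt z (hU.differentiable one_ne_zero z).hasFDerivAt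
  have h3 : fderiv ℝ (fun z => levelCutoff ε t (U z)) z =
      deriv (levelCutoff ε t) (U z) • fderiv ℝ U z := h2.fderiv
  have h4 : gradNorm (fun z => levelCutoff ε t (U z)) z =
      |deriv (levelCutoff ε t) (U z)| * gradNorm U z := by
    unfold gradNorm
    rw [h3, ContinuousLinearMap.smul_comp, norm_smul, smul_apply, smul_eq_mul, mul_pow, mul_pow,
      norm_eq_abs, sq_abs, ← mul_add, sqrt_mul (sq_nonneg _), sqrt_sq_eq_abs]
  rw [h4]
  exact mul_le_mul_of_nonneg_right (abs_deriv_levelCutoff_le hε t _) (gradNorm_nonneg _ _)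

theorem Antitone.integral_sub_integral_comp_add_le {g : ℝ → ℝ} (hg : Antitone g) {ε M B : ℝ}
    (hε : 0 ≤ ε) (h0 : ∀ t, 0 ≤ g t) (hB : ∀ t, g t ≤ B) :
    (∫ t in (0 : ℝ)..M, g t) - ∫ t in (0 : ℝ)..M, g (t + ε) ≤ ε * B := by
  have hi : ∀ a b, IntervalIntegrable g volume a b := fun a b => hg.intervalIntegrable
  rw [intervalIntegral.integral_comp_add_right, zero_add,
    ← intervalIntegral.integral_add_adjacent_intervals (hi 0 ε) (hi ε M),
    ← intervalIntegral.integral_add_adjacent_intervals (hi ε M) (hi M (M + ε))]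
  have h1 : 0 ≤ ∫ t in M..(M + ε), g t :=
    intervalIntegral.integral_nonneg (by linarith) fun t _ => h0 t
  have h2 : ∫ t in (0 : ℝ)..ε, g t ≤ ∫ t in (0 : ℝ)..ε, B :=
    intervalIntegral.integral_mono_on hε (hi _ _) (by simp) fun t _ => hB t
  rw [intervalIntegral.integral_const, sub_zero, smul_eq_mul] at h2
  linarith

end LevelCutoff

section LevelSets

/-- The measure `y⁻ᵏ dx dy` restricted to `S`. -/
noncomputable def invPowMeasure {E : Type*} [MeasureSpace E] (k : ℕ) (S : Set (E × ℝ)) :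
    Measure (E × ℝ) :=
  (volume.restrict S).withDensity fun z => ENNReal.ofReal ((z.2 ^ k)⁻¹)

theorem integral_invPowMeasure {E : Type*} [MeasureSpace E] {k : ℕ} {S : Set (E × ℝ)}
    (hS : MeasurableSet S) (hpos : ∀ z ∈ S, 0 < z.2) {f : E × ℝ → ℝ} (hf : ∀ z, z ∉ S → f z = 0) :
    ∫ z, f z ∂(invPowMeasure k S) = ∫ z, f z * (z.2 ^ k)⁻¹ := by
  rw [invPowMeasure, integral_withDensity_eq_integral_toReal_smul (by fun_prop) (by simp)]
  rw [← setIntegral_eq_integral_of_forall_compl_eq_zero (s := S)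
    (f := fun z => f z * (z.2 ^ k)⁻¹) fun z hz => by simp [hf z hz]]
  refine setIntegral_congr_fun hS fun z hz => ?_
  have := hpos z hz
  simp only [smul_eq_mul]
  rw [ENNReal.toReal_ofReal (by positivity), mul_comm]

variable {m : ℕ} {U : EuclideanSpace ℝ (Fin m) × ℝ → ℝ}

theorem isFiniteMeasure_invPowMeasure {k : ℕ} {S : Set (EuclideanSpace ℝ (Fin m) × ℝ)}
    (hS : IsCompact S) (hpos : ∀ z ∈ S, 0 < z.2) : IsFiniteMeasure (invPowMeasure k S) := by
  refine isFiniteMeasure_withDensity_ofReal (Integrable.hasFiniteIntegral ?_)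
  refine ContinuousOn.integrableOn_compact hS ?_
  exact ContinuousOn.inv₀ (by fun_prop) fun z hz => pow_ne_zero _ (hpos z hz).ne'

theorem rpow_level_le (hm : 0 < m) (hU : ContDiff ℝ 1 U) (hUs : HasCompactSupport U)
    (hUO : ∀ z ∈ tsupport U, 0 < z.2) {D : ℝ → ℝ}
    (hD : ∀ t, D t = (invPowMeasure (m + 1) (tsupport U)).real {z | t < |U z|}) {t ε : ℝ}
    (ht : 0 < t) (hε : 0 < ε) :
    ((m : ℝ) ^ (m + 1) * D (t + ε) ^ (m + 1) +
      ((m : ℝ) + 1) ^ (m + 1) * unitBallVol (m + 1) * D (t + ε) ^ m) ^ (1 / ((m : ℝ) + 1)) ≤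
      (∫ z, levelSlope ε t (U z) * (gradNorm U z * (z.2 ^ m)⁻¹)) + m * (D t - D (t + ε)) := by
  have hm' : (0 : ℝ) < m := by exact_mod_cast hm
  set ν := invPowMeasure (m + 1) (tsupport U) with hν
  have hSm : MeasurableSet (tsupport U) := (isClosed_tsupport U).measurableSet
  have hfin : IsFiniteMeasure ν := isFiniteMeasure_invPowMeasure hUs hUO
  set a : ℝ := ((m : ℝ) + 1) / m with ha
  have ha0 : a ≠ 0 := by positivity
  set v : EuclideanSpace ℝ (Fin m) × ℝ → ℝ := fun z => levelCutoff ε t (U z) with hv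
  have hvU : ∀ z, U z = 0 → v z = 0 := fun z hz =>
    levelCutoff_eq_zero hε (by rw [hz, abs_zero]; exact ht.le)
  have hvd : ContDiff ℝ 1 v := (contDiff_levelCutoff ε t).comp hU
  have hvs : tsupport v ⊆ tsupport U :=
    closure_mono fun z (hz : v z ≠ 0) (h : U z = 0) => hz (hvU z h)
  have hvc : HasCompactSupport v := hUs.mono' ((subset_tsupport v).trans hvs)
  have hv0 : ∀ z, 0 ≤ v z := fun z => levelCutoff_nonneg _ _ _
  have hv1 : ∀ z, v z ≤ 1 := fun z => levelCutoff_le_one hε ht.le _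
  have hoff : ∀ z, z ∉ tsupport U → v z = 0 := fun z hz =>
    hvU z (image_eq_zero_of_notMem_tsupport hz)
  have hmv : Measurable v := hvd.continuous.measurable
  have hva0 : ∀ z, 0 ≤ v z ^ a := fun z => rpow_nonneg (hv0 z) _
  have hva1 : ∀ z, v z ^ a ≤ 1 := fun z => rpow_le_one (hv0 z) (hv1 z) (by positivity)
  have hms : ∀ s, MeasurableSet {z | s < |U z|} := fun s =>
    measurableSet_lt measurable_const hU.continuous.abs.measurable
  have hi1 : Integrable (fun z => v z ^ a) ν :=
    Integrable.of_bound (hmv.pow_const a).aestronglyMeasurable 1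
      (Eventually.of_forall fun z => by rw [norm_eq_abs, abs_of_nonneg (hva0 z)]; exact hva1 z)
  have hi2 : Integrable v ν :=
    Integrable.of_bound hmv.aestronglyMeasurable 1
      (Eventually.of_forall fun z => by rw [norm_eq_abs, abs_of_nonneg (hv0 z)]; exact hv1 z)
  have hind : ∀ s, Integrable ({z | s < |U z|}.indicator fun _ => (1 : ℝ)) ν := fun s =>
    (integrable_const 1).indicator (hms s)
  have hDi : ∀ s, D s = ∫ z, {z | s < |U z|}.indicator (fun _ => (1 : ℝ)) z ∂ν := fun s => by
    rw [integral_indicator (hms s), setIntegral_const, smul_eq_mul, mul_one, hD]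
  have hone : ∀ z, t + ε < |U z| → v z = 1 := fun z hz => levelCutoff_eq_one hε ht.le hz.le
  have hC : D (t + ε) ≤ ∫ z, v z ^ a ∂ν := by
    rw [hDi]
    refine integral_mono (hind _) hi1 fun z => ?_
    by_cases hz : t + ε < |U z|
    · simp [hz, hone z hz]
    · simpa [hz] using hva0 z
  have hdiff : ∫ z, (v z - v z ^ a) ∂ν ≤ D t - D (t + ε) := by
    rw [hDi, hDi, ← integral_sub (hind _) (hind _)]
    refine integral_mono (hi2.sub hi1) ((hind _).sub (hind _)) fun z => ?_
    by_cases hz : t + ε < |U z|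
    · have : t < |U z| := by linarith
      simp [hz, hone z hz, this]
    · by_cases hz2 : t < |U z|
      · simp only [indicator, mem_ofPred_eq, hz, hz2, if_true, if_false]
        linarith [hva0 z, hv1 z]
      · have : v z = 0 := levelCutoff_eq_zero hε (not_lt.1 hz2)
        simp [hz, hz2, this, zero_rpow ha0]
  have hkey := pow_add_pow_le_of_le_one hm hvd hvc (fun z hz => hUO z (hvs hz)) hv0 hv1
    (C := ∫ z, v z ^ a ∂ν) (integral_invPowMeasure hSm hUO fun z hz => by
      rw [hoff z hz, zero_rpow ha0])
  rw [← ha, ← integral_invPowMeasure (f := fun z => v z - v z ^ a) hSm hUO fun z hz => by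
      rw [hoff z hz, zero_rpow ha0, sub_zero]] at hkey
  have hpO : ContinuousOn (fun y : ℝ => (y ^ m)⁻¹) (Ioi 0) :=
    ContinuousOn.inv₀ (by fun_prop) fun y hy => pow_ne_zero _ (ne_of_gt hy)
  have hgc : ∀ {w : EuclideanSpace ℝ (Fin m) × ℝ → ℝ}, ContDiff ℝ 1 w →
      tsupport w ⊆ tsupport U → Continuous fun z => gradNorm w z * (z.2 ^ m)⁻¹ := fun hw hwU =>
    continuous_mul_comp_snd (continuous_gradNorm hw) isOpen_Ioi hpO fun z hz =>
      hUO z (hwU (tsupport_gradNorm_subset _ hz))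
  have hgs : ∀ {w : EuclideanSpace ℝ (Fin m) × ℝ → ℝ},
      tsupport w ⊆ tsupport U → HasCompactSupport fun z => gradNorm w z * (z.2 ^ m)⁻¹ :=
    fun {w} hwU => HasCompactSupport.mul_right (f := gradNorm w)
      (hUs.mono' ((subset_tsupport _).trans ((tsupport_gradNorm_subset w).trans hwU)))
  have hsc : Continuous fun z => levelSlope ε t (U z) :=
    (continuous_levelSlope ε).comp (continuous_const.prodMk hU.continuous)
  have hgrad : ∫ z, gradNorm v z * (z.2 ^ m)⁻¹ ≤
      ∫ z, levelSlope ε t (U z) * (gradNorm U z * (z.2 ^ m)⁻¹) := by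
    refine integral_mono ((hgc hvd hvs).integrable_of_hasCompactSupport (hgs hvs))
      ((hsc.mul (hgc hU subset_rfl)).integrable_of_hasCompactSupport
        ((hgs subset_rfl).mul_left)) fun z => ?_
    by_cases hz : z ∈ tsupport U
    · have := hUO z hz
      simp only
      rw [← mul_assoc]
      exact mul_le_mul_of_nonneg_right (gradNorm_levelCutoff_comp_le hU hε t z) (by positivity)
    · have h1 : gradNorm v z = 0 := image_eq_zero_of_notMem_tsupport fun h =>
        hz (hvs (tsupport_gradNorm_subset v h))
      have h2 : gradNorm U z = 0 := image_eq_zero_of_notMem_tsupport fun h =>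
        hz (tsupport_gradNorm_subset U h)
      simp [h1, h2]
  have hD0 : 0 ≤ D (t + ε) := by rw [hD]; exact measureReal_nonneg
  have hσ := unitBallVol_pos (m + 1)
  have hQ0 : 0 ≤ (∫ z, gradNorm v z * (z.2 ^ m)⁻¹) + m * ∫ z, (v z - v z ^ a) ∂ν := by
    refine add_nonneg (integral_nonneg fun z => ?_) (mul_nonneg hm'.le (integral_nonneg fun z => ?_))
    · by_cases hz : z ∈ tsupport U
      · have := hUO z hz
        exact mul_nonneg (gradNorm_nonneg _ _) (by positivity)
      · have h1 : gradNorm v z = 0 := image_eq_zero_of_notMem_tsupport fun h =>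
          hz (hvs (tsupport_gradNorm_subset v h))
        simp [h1]
    · have : v z ^ a ≤ v z := by
        have h : 1 ≤ a := by rw [ha, le_div_iff₀ hm']; linarith
        exact (rpow_le_rpow_of_exponent_ge' (hv0 z) (hv1 z) zero_le_one h).trans_eq (rpow_one _)
      simpa using this
  have hnat : ((m + 1 : ℕ) : ℝ) = (m : ℝ) + 1 := by push_cast; rfl
  calc _ ≤ (((∫ z, gradNorm v z * (z.2 ^ m)⁻¹) + m * ∫ z, (v z - v z ^ a) ∂ν) ^ (m + 1)) ^
        (1 / ((m : ℝ) + 1)) := by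
        refine rpow_le_rpow (by positivity) (le_trans ?_ hkey) (by positivity)
        gcongr
    _ = (∫ z, gradNorm v z * (z.2 ^ m)⁻¹) + m * ∫ z, (v z - v z ^ a) ∂ν := by
        rw [← hnat, one_div, pow_rpow_inv_natCast hQ0 (Nat.succ_ne_zero m)]
    _ ≤ _ := by gcongr

end LevelSets

section HalfSpace

variable {m : ℕ} {U : EuclideanSpace ℝ (Fin m) × ℝ → ℝ}

theorem integral_integral_levelSlope_le {X : Type*} [TopologicalSpace X] [MeasurableSpace X]
    [BorelSpace X] [SecondCountableTopology X] {μ : Measure X} [SFinite μ] {F G : X → ℝ}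
    (hF : Continuous F) (hG : Integrable G μ) (hG0 : ∀ x, 0 ≤ G x) {ε M : ℝ} (hε : 0 < ε)
    (hM : 0 ≤ M) :
    IntervalIntegrable (fun t => ∫ x, levelSlope ε t (F x) * G x ∂μ) volume 0 M ∧
      ∫ t in (0 : ℝ)..M, (∫ x, levelSlope ε t (F x) * G x ∂μ) ≤ ∫ x, G x ∂μ := by
  obtain ⟨K, hK⟩ := exists_levelSlope_le hε
  have hc : Continuous fun q : ℝ × X => levelSlope ε q.1 (F q.2) :=
    (continuous_levelSlope ε).comp (continuous_fst.prodMk (hF.comp continuous_snd))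
  have hint : Integrable (Function.uncurry fun (t : ℝ) (x : X) => levelSlope ε t (F x) * G x)
      ((volume.restrict (Ioc 0 M)).prod μ) :=
    (hG.comp_snd (volume.restrict (Ioc 0 M))).bdd_mul (c := K) hc.measurable.aestronglyMeasurable
      (Eventually.of_forall fun q => by
        rw [norm_eq_abs, abs_of_nonneg (levelSlope_nonneg hε _ _)]; exact hK _ _)
  constructor
  · rw [intervalIntegrable_iff_integrableOn_Ioc_of_le hM]
    exact hint.integral_prod_left
  · rw [intervalIntegral.integral_of_le hM, integral_integral_swap hint]
    refine integral_mono hint.integral_prod_right hG fun x => ?_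
    simp only
    rw [integral_mul_const, ← intervalIntegral.integral_of_le hM]
    exact (mul_le_mul_of_nonneg_right (integral_levelSlope_le_one hε M (F x)) (hG0 x)).trans_eq
      (one_mul _)

/-- The inequality in the half-space model. -/
theorem pow_add_pow_le_integral_gradNorm (hm : 0 < m) (hU : ContDiff ℝ 1 U)
    (hUs : HasCompactSupport U) (hUO : ∀ z ∈ tsupport U, 0 < z.2) :
    (m : ℝ) ^ (m + 1) * (∫ z, |U z| * (z.2 ^ (m + 1))⁻¹) ^ (m + 1) +
      ((m : ℝ) + 1) ^ (m + 1) * unitBallVol (m + 1) *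
        (∫ z, |U z| ^ (((m : ℝ) + 1) / m) * (z.2 ^ (m + 1))⁻¹) ^ m ≤
      (∫ z, gradNorm U z * (z.2 ^ m)⁻¹) ^ (m + 1) := by
  have hm' : (0 : ℝ) < m := by exact_mod_cast hm
  have hSm : MeasurableSet (tsupport U) := (isClosed_tsupport U).measurableSet
  have hfin : IsFiniteMeasure (invPowMeasure (m + 1) (tsupport U)) :=
    isFiniteMeasure_invPowMeasure hUs hUO
  set ν := invPowMeasure (m + 1) (tsupport U) with hν
  have hσ := unitBallVol_pos (m + 1)
  obtain ⟨M, hM⟩ := hU.continuous.bounded_above_of_compact_support hUs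
  have hM0 : 0 ≤ M := (norm_nonneg _).trans (hM 0)
  have hz0 : ∀ z, z ∉ tsupport U → U z = 0 := fun z hz => image_eq_zero_of_notMem_tsupport hz
  rw [← integral_invPowMeasure (f := fun z => |U z|) hSm hUO fun z hz => by rw [hz0 z hz, abs_zero],
    ← integral_invPowMeasure (f := fun z => |U z| ^ (((m : ℝ) + 1) / m)) hSm hUO fun z hz => by
      rw [hz0 z hz, abs_zero, zero_rpow (by positivity)]]
  refine pow_add_pow_le_of_integral_level_le hm hσ.le hU.continuous.abs.measurable
    (fun z => abs_nonneg _) hM0 hM ?_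
  set D : ℝ → ℝ := fun t => ν.real {z | t < |U z|} with hD
  set ψ : ℝ → ℝ := fun t => ((m : ℝ) ^ (m + 1) * D t ^ (m + 1) +
      ((m : ℝ) + 1) ^ (m + 1) * unitBallVol (m + 1) * D t ^ m) ^ (1 / ((m : ℝ) + 1)) with hψ
  set G : EuclideanSpace ℝ (Fin m) × ℝ → ℝ := fun z => gradNorm U z * (z.2 ^ m)⁻¹ with hG
  change ∫ t in (0 : ℝ)..M, ψ t ≤ ∫ z, G z
  have hD0 : ∀ t, 0 ≤ D t := fun t => measureReal_nonneg
  have hDa : Antitone D := antitone_measureReal_lt _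
  set V := ν.real univ with hV
  have hDV : ∀ t, D t ≤ V := fun t => measureReal_mono (subset_univ _)
  have hV0 : 0 ≤ V := measureReal_nonneg
  set B : ℝ := ((m : ℝ) ^ (m + 1) * V ^ (m + 1) +
      ((m : ℝ) + 1) ^ (m + 1) * unitBallVol (m + 1) * V ^ m) ^ (1 / ((m : ℝ) + 1)) with hB
  have hmono : ∀ x y : ℝ, 0 ≤ x → x ≤ y → ((m : ℝ) ^ (m + 1) * x ^ (m + 1) +
      ((m : ℝ) + 1) ^ (m + 1) * unitBallVol (m + 1) * x ^ m) ^ (1 / ((m : ℝ) + 1)) ≤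
      ((m : ℝ) ^ (m + 1) * y ^ (m + 1) +
      ((m : ℝ) + 1) ^ (m + 1) * unitBallVol (m + 1) * y ^ m) ^ (1 / ((m : ℝ) + 1)) := by
    intro x y hx hxy
    refine rpow_le_rpow (by positivity) ?_ (by positivity)
    gcongr
  have hψa : Antitone ψ := fun s t h => hmono _ _ (hD0 t) (hDa h)
  have hψ0 : ∀ t, 0 ≤ ψ t := fun t => by
    have := hD0 t
    positivity
  have hψB : ∀ t, ψ t ≤ B := fun t => hmono _ _ (hD0 t) (hDV t)
  have hpO : ContinuousOn (fun y : ℝ => (y ^ m)⁻¹) (Ioi 0) :=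
    ContinuousOn.inv₀ (by fun_prop) fun y hy => pow_ne_zero _ (ne_of_gt hy)
  have hGi : Integrable G :=
    (continuous_mul_comp_snd (continuous_gradNorm hU) isOpen_Ioi hpO fun z hz =>
      hUO z (tsupport_gradNorm_subset _ hz)).integrable_of_hasCompactSupport
      (HasCompactSupport.mul_right (f := gradNorm U)
      (hUs.mono' ((subset_tsupport _).trans (tsupport_gradNorm_subset U))))
  have hG0 : ∀ z, 0 ≤ G z := fun z => by
    by_cases hz : z ∈ tsupport U
    · have := hUO z hz
      exact mul_nonneg (gradNorm_nonneg _ _) (by positivity)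
    · have h1 : gradNorm U z = 0 := image_eq_zero_of_notMem_tsupport fun h =>
        hz (tsupport_gradNorm_subset U h)
      simp [hG, h1]
  have hε : ∀ ε : ℝ, 0 < ε → ∫ t in (0 : ℝ)..M, ψ t ≤ (∫ z, G z) + ε * (m * V + B) := by
    intro ε hε
    obtain ⟨hi, hle⟩ := integral_integral_levelSlope_le (μ := volume) hU.continuous hGi hG0 hε hM0
    have hanti : ∀ {g : ℝ → ℝ}, Antitone g → Antitone fun t => g (t + ε) :=
      fun hg s t h => hg (by linarith)
    have hDi := hDa.intervalIntegrable (μ := volume) (a := 0) (b := M)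
    have hDi2 := (hanti hDa).intervalIntegrable (μ := volume) (a := 0) (b := M)
    have h1 := intervalIntegral.integral_mono_on_of_le_Ioo hM0
      (hanti hψa).intervalIntegrable (hi.add ((hDi.sub hDi2).const_mul (m : ℝ)))
      fun t ht => rpow_level_le hm hU hUs hUO (D := D) (fun _ => rfl) ht.1 hε
    rw [intervalIntegral.integral_add hi ((hDi.sub hDi2).const_mul (m : ℝ)),
      intervalIntegral.integral_const_mul, intervalIntegral.integral_sub hDi hDi2] at h1
    have h2 := hDa.integral_sub_integral_comp_add_le (M := M) hε.le hD0 hDV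
    have h3 := hψa.integral_sub_integral_comp_add_le (M := M) hε.le hψ0 hψB
    have h4 := mul_le_mul_of_nonneg_left h2 hm'.le
    change ∫ t in (0 : ℝ)..M, ψ (t + ε) ≤ _ at h1
    linarith
  refine le_of_forall_pos_le_add fun δ hδ => ?_
  have hc : 0 < m * V + B + 1 := by positivity
  refine (hε (δ / (m * V + B + 1)) (by positivity)).trans ?_
  gcongr
  rw [div_mul_eq_mul_div, div_le_iff₀ hc]
  exact mul_le_mul_of_nonneg_left (by linarith) hδ.le

end HalfSpace

section BallToHalfSpace

open EuclideanGeometry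

variable {F : Type*} [NormedAddCommGroup F] [InnerProductSpace ℝ F] {e : F}

theorem ne_neg_of_inner_pos {x : F} (he : ‖e‖ = 1) (hx : 0 < inner ℝ x e) : x ≠ -e := by
  rintro rfl
  rw [inner_neg_left, real_inner_self_eq_norm_sq, he] at hx
  norm_num at hx

theorem sqrt_two_div_dist_sq {F : Type*} [SeminormedAddCommGroup F] (e x : F) : (√2 / dist x (-e)) ^ 2 = 2 / ‖x + e‖ ^ 2 := by
  rw [div_pow, sq_sqrt zero_le_two, dist_eq_norm, sub_neg_eq_add]

theorem one_sub_norm_inversion_sq {x : F} (he : ‖e‖ = 1) (hx : x ≠ -e) :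
    1 - ‖inversion (-e) √2 x‖ ^ 2 = 2 * (2 / ‖x + e‖ ^ 2 * inner ℝ x e) := by
  have h0 : ‖x + e‖ ^ 2 ≠ 0 :=
    pow_ne_zero _ (norm_ne_zero_iff.2 fun h => hx (eq_neg_of_add_eq_zero_left h))
  have h1 : inversion (-e) √2 x = (2 / ‖x + e‖ ^ 2) • (x + e) - e := by
    rw [inversion, sqrt_two_div_dist_sq, vsub_eq_sub, sub_neg_eq_add, vadd_eq_add, sub_eq_add_neg]
  rw [h1, norm_sub_sq_real, inner_smul_left, inner_add_left, real_inner_self_eq_norm_sq, he,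
    norm_smul, mul_pow, norm_eq_abs, sq_abs]
  simp only [conj_trivial]
  field_simp
  ring

theorem image_inversion_inner_pos (he : ‖e‖ = 1) :
    inversion (-e) √2 '' {x | 0 < inner ℝ x e} = Metric.ball 0 1 := by
  have hR : √2 ≠ 0 := by positivity
  have key : ∀ x : F, x ≠ -e → (‖inversion (-e) √2 x‖ < 1 ↔ 0 < inner ℝ x e) := by
    intro x hx
    have h0 : 0 < ‖x + e‖ := norm_pos_iff.2 fun h => hx (eq_neg_of_add_eq_zero_left h)
    have h1 : (0 : ℝ) < 2 * (2 / ‖x + e‖ ^ 2) := by positivity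
    have h2 := one_sub_norm_inversion_sq he hx
    rw [← mul_assoc] at h2
    rw [← mul_pos_iff_of_pos_left h1, ← h2, sub_pos, sq_lt_one_iff₀ (norm_nonneg _)]
  ext y
  rw [mem_ball_zero_iff]
  constructor
  · rintro ⟨x, hx, rfl⟩
    exact (key x (ne_neg_of_inner_pos he hx)).2 hx
  · intro hy
    refine ⟨inversion (-e) √2 y, (key _ fun h => ?_).1 ?_, inversion_inversion _ hR _⟩
    · rw [inversion_eq_center hR] at h
      rw [h, norm_neg, he] at hy
      exact lt_irrefl _ hy
    · rwa [inversion_inversion _ hR]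

theorem norm_fderiv_comp_inversion {u : F → ℝ} (hu : Differentiable ℝ u) {x : F} (hx : x ≠ -e) :
    ‖fderiv ℝ (u ∘ inversion (-e) √2) x‖ =
      2 / ‖x + e‖ ^ 2 * ‖fderiv ℝ u (inversion (-e) √2 x)‖ := by
  have h := (hu (inversion (-e) √2 x)).hasFDerivAt.comp x (hasFDerivAt_inversion (R := √2) hx)
  rw [h.fderiv, sqrt_two_div_dist_sq, ContinuousLinearMap.comp_smul, norm_smul, norm_eq_abs,
    abs_of_nonneg (by positivity)]
  congr 1
  exact ContinuousLinearMap.opNorm_comp_linearIsometryEquiv _ _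

theorem tsupport_comp_inversion_subset {u : F → ℝ} (hus : HasCompactSupport u)
    (hu : tsupport u ⊆ Metric.ball 0 1) (he : ‖e‖ = 1) :
    IsCompact (inversion (-e) √2 '' tsupport u) ∧
      tsupport (u ∘ inversion (-e) √2) ⊆ inversion (-e) √2 '' tsupport u ∧
      inversion (-e) √2 '' tsupport u ⊆ {x | 0 < inner ℝ x e} := by
  have hR : √2 ≠ 0 := by positivity
  have hc : ∀ x ∈ tsupport u, x ≠ -e := by
    rintro x hx rfl
    have := hu hx
    rw [mem_ball_zero_iff, norm_neg, he] at this
    exact lt_irrefl _ this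
  have hK : IsCompact (inversion (-e) √2 '' tsupport u) :=
    IsCompact.image_of_continuousOn hus
      (continuousOn_const.inversion continuousOn_const continuousOn_id hc)
  refine ⟨hK, closure_minimal (fun x hx => ?_) hK.isClosed, ?_⟩
  · exact ⟨inversion (-e) √2 x, subset_tsupport u hx, inversion_inversion _ hR _⟩
  · rintro _ ⟨x, hx, rfl⟩
    have := hu hx
    rw [← image_inversion_inner_pos he] at this
    obtain ⟨y, hy, rfl⟩ := this
    rwa [inversion_inversion _ hR]

theorem contDiff_comp_inversion {u : F → ℝ} (hud : ContDiff ℝ 1 u) (hus : HasCompactSupport u)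
    (hu : tsupport u ⊆ Metric.ball 0 1) (he : ‖e‖ = 1) :
    ContDiff ℝ 1 (u ∘ inversion (-e) √2) := by
  obtain ⟨-, h1, h2⟩ := tsupport_comp_inversion_subset hus hu he
  refine contDiff_iff_contDiffAt.2 fun x => ?_
  by_cases hx : x ∈ tsupport (u ∘ inversion (-e) √2)
  swap
  · exact contDiffAt_const.congr_of_eventuallyEq (notMem_tsupport_iff_eventuallyEq.1 hx)
  exact hud.contDiffAt.comp x
    (contDiffAt_const.inversion contDiffAt_const contDiffAt_id (ne_neg_of_inner_pos he (h2 (h1 hx))))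

variable [FiniteDimensional ℝ F] [MeasurableSpace F] [BorelSpace F]

/-- Change of variables from the ball model to the half-space model. -/
theorem integral_ball_eq_integral_inner_pos {k : ℕ} (hk : Module.finrank ℝ F = k) (he : ‖e‖ = 1)
    (g : F → ℝ) :
    ∫ x in Metric.ball (0 : F) 1, g x * (2 / (1 - ‖x‖ ^ 2)) ^ k =
      ∫ x in {x | 0 < inner ℝ x e}, g (inversion (-e) √2 x) * (inner ℝ x e ^ k)⁻¹ := by
  have hR : √2 ≠ 0 := by positivity
  have hms : MeasurableSet {x : F | 0 < inner ℝ x e} :=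
    (isOpen_lt continuous_const (continuous_id.inner continuous_const)).measurableSet
  rw [← image_inversion_inner_pos he, integral_image_eq_integral_abs_det_fderiv_smul volume hms
    (fun x hx => (hasFDerivAt_inversion (ne_neg_of_inner_pos he hx)).hasFDerivWithinAt)
    (inversion_injective _ hR).injOn]
  refine setIntegral_congr_fun hms fun x (hx : 0 < inner ℝ x e) => ?_
  have hne := ne_neg_of_inner_pos he hx
  have h0 : 0 < ‖x + e‖ := norm_pos_iff.2 fun h => hne (eq_neg_of_add_eq_zero_left h)
  have hdet : ∀ (s : ℝ) (K : Submodule ℝ F), 0 ≤ s →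
      |(s • (K.reflection : F →L[ℝ] F)).det| = s ^ k := by
    intro s K hs
    have : (s • (K.reflection : F →L[ℝ] F)).det =
        s ^ k * LinearMap.det K.reflection.toLinearMap := by
      rw [← hk, ← LinearMap.det_smul]
      rfl
    rw [this, Submodule.det_reflection, abs_mul, abs_pow, abs_pow, abs_neg, abs_one, one_pow,
      mul_one, abs_of_nonneg hs]
  simp only [smul_eq_mul]
  rw [hdet _ _ (by positivity), sqrt_two_div_dist_sq, one_sub_norm_inversion_sq he hne]
  have hs : 0 < 2 / ‖x + e‖ ^ 2 := by positivity
  generalize 2 / ‖x + e‖ ^ 2 = s at hs ⊢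
  have h2 : 2 / (2 * (s * inner ℝ x e)) = s⁻¹ * (inner ℝ x e)⁻¹ := by
    field_simp
  rw [h2, mul_pow, inv_pow, inv_pow]
  field_simp

end BallToHalfSpace

section BallToHalfSpace

open EuclideanGeometry

theorem inner_prod_equiv_snd {m : ℕ} {F : Type*} [NormedAddCommGroup F] [InnerProductSpace ℝ F]
    (φ : (EuclideanSpace ℝ (Fin m) × ℝ) ≃L[ℝ] F)
    (hφ : ∀ z, ‖φ z‖ = √(‖z.1‖ ^ 2 + z.2 ^ 2)) (z : EuclideanSpace ℝ (Fin m) × ℝ) :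
    inner ℝ (φ z) (φ (0, 1)) = z.2 := by
  have hsq : ∀ z, ‖φ z‖ ^ 2 = ‖z.1‖ ^ 2 + z.2 ^ 2 := fun z => by
    rw [hφ, sq_sqrt (by positivity)]
  have h := norm_add_sq_real (φ z) (φ (0, 1))
  rw [← map_add, hsq, hsq, hsq] at h
  simp only [Prod.fst_add, Prod.snd_add, add_zero, norm_zero] at h
  linarith

theorem pow_add_pow_le_ball {m : ℕ} (hm : 0 < m) {u : EuclideanSpace ℝ (Fin (m + 1)) → ℝ}
    (hu : ContDiff ℝ 1 u) (hsupp : tsupport u ⊆ Metric.ball 0 1) :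
    (m : ℝ) ^ (m + 1) * (∫ x in Metric.ball (0 : EuclideanSpace ℝ (Fin (m + 1))) 1,
        |u x| * (2 / (1 - ‖x‖ ^ 2)) ^ (m + 1)) ^ (m + 1) +
      ((m : ℝ) + 1) ^ (m + 1) * unitBallVol (m + 1) *
        (∫ x in Metric.ball (0 : EuclideanSpace ℝ (Fin (m + 1))) 1,
          |u x| ^ (((m : ℝ) + 1) / m) * (2 / (1 - ‖x‖ ^ 2)) ^ (m + 1)) ^ m ≤
      (∫ x in Metric.ball (0 : EuclideanSpace ℝ (Fin (m + 1))) 1,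
        (1 - ‖x‖ ^ 2) / 2 * ‖fderiv ℝ u x‖ * (2 / (1 - ‖x‖ ^ 2)) ^ (m + 1)) ^ (m + 1) := by
  obtain ⟨φ, hφm, hφ⟩ := exists_prod_equiv m
  set e := φ (0, 1) with he_def
  have he : ‖e‖ = 1 := by rw [he_def, hφ]; simp
  have hin : ∀ z, inner ℝ (φ z) e = z.2 := inner_prod_equiv_snd φ hφ
  have hfr : Module.finrank ℝ (EuclideanSpace ℝ (Fin (m + 1))) = m + 1 :=
    finrank_euclideanSpace_fin
  have hus : HasCompactSupport u :=
    (isCompact_closedBall (0 : EuclideanSpace ℝ (Fin (m + 1))) 1).of_isClosed_subset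
      (isClosed_tsupport u) (hsupp.trans Metric.ball_subset_closedBall)
  obtain ⟨hK, hwK, hKO⟩ := tsupport_comp_inversion_subset hus hsupp he
  have hw := contDiff_comp_inversion hu hus hsupp he
  set w := u ∘ inversion (-e) √2 with hw_def
  have hws : HasCompactSupport w := hK.of_isClosed_subset (isClosed_tsupport w) hwK
  set U := w ∘ φ with hU_def
  have hU : ContDiff ℝ 1 U := hw.comp φ.contDiff
  have hUs : HasCompactSupport U := hws.comp_homeomorph φ.toHomeomorph
  have hUw : tsupport U ⊆ φ ⁻¹' tsupport w :=
    closure_minimal (fun z hz => subset_tsupport w hz)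
      ((isClosed_tsupport w).preimage φ.continuous)
  have hUO : ∀ z ∈ tsupport U, 0 < z.2 := fun z hz => by
    have : 0 < inner ℝ (φ z) e := hKO (hwK (hUw hz))
    rwa [hin] at this
  have hemb : MeasurableEmbedding φ := φ.toHomeomorph.measurableEmbedding
  have hpre : φ ⁻¹' {x | 0 < inner ℝ x e} = {z | 0 < z.2} := by
    ext z
    rw [mem_preimage, mem_ofPred_eq, hin, mem_ofPred_eq]
  have hcv : ∀ g : EuclideanSpace ℝ (Fin (m + 1)) → ℝ,
      ∫ x in Metric.ball (0 : EuclideanSpace ℝ (Fin (m + 1))) 1,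
        g x * (2 / (1 - ‖x‖ ^ 2)) ^ (m + 1) =
      ∫ z in {z : EuclideanSpace ℝ (Fin m) × ℝ | 0 < z.2},
        g (inversion (-e) √2 (φ z)) * (z.2 ^ (m + 1))⁻¹ := by
    intro g
    rw [integral_ball_eq_integral_inner_pos hfr he, ← hφm.setIntegral_preimage_emb hemb, hpre]
    simp only [hin]
  have hms : MeasurableSet {z : EuclideanSpace ℝ (Fin m) × ℝ | 0 < z.2} :=
    measurableSet_lt measurable_const measurable_snd
  have hoff : ∀ z : EuclideanSpace ℝ (Fin m) × ℝ, z ∉ {z | 0 < z.2} → z ∉ tsupport U :=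
    fun z hz h => hz (hUO z h)
  rw [hcv (fun x => |u x|), hcv (fun x => |u x| ^ (((m : ℝ) + 1) / m)),
    hcv (fun x => (1 - ‖x‖ ^ 2) / 2 * ‖fderiv ℝ u x‖)]
  have h1 : ∫ z in {z : EuclideanSpace ℝ (Fin m) × ℝ | 0 < z.2},
      |u (inversion (-e) √2 (φ z))| * (z.2 ^ (m + 1))⁻¹ = ∫ z, |U z| * (z.2 ^ (m + 1))⁻¹ :=
    setIntegral_eq_integral_of_forall_compl_eq_zero (f := fun z => |U z| * (z.2 ^ (m + 1))⁻¹)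
      fun z hz => by
        rw [image_eq_zero_of_notMem_tsupport (hoff z hz), abs_zero, zero_mul]
  have h2 : ∫ z in {z : EuclideanSpace ℝ (Fin m) × ℝ | 0 < z.2},
      |u (inversion (-e) √2 (φ z))| ^ (((m : ℝ) + 1) / m) * (z.2 ^ (m + 1))⁻¹ =
      ∫ z, |U z| ^ (((m : ℝ) + 1) / m) * (z.2 ^ (m + 1))⁻¹ :=
    setIntegral_eq_integral_of_forall_compl_eq_zero
      (f := fun z => |U z| ^ (((m : ℝ) + 1) / m) * (z.2 ^ (m + 1))⁻¹)
      fun z hz => by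
        rw [image_eq_zero_of_notMem_tsupport (hoff z hz), abs_zero, zero_rpow (by positivity),
          zero_mul]
  have h3 : ∫ z in {z : EuclideanSpace ℝ (Fin m) × ℝ | 0 < z.2},
      (1 - ‖inversion (-e) √2 (φ z)‖ ^ 2) / 2 * ‖fderiv ℝ u (inversion (-e) √2 (φ z))‖ *
        (z.2 ^ (m + 1))⁻¹ = ∫ z, ‖fderiv ℝ w (φ z)‖ * (z.2 ^ m)⁻¹ := by
    rw [← setIntegral_eq_integral_of_forall_compl_eq_zero
      (s := {z : EuclideanSpace ℝ (Fin m) × ℝ | 0 < z.2})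
      (f := fun z => ‖fderiv ℝ w (φ z)‖ * (z.2 ^ m)⁻¹)]
    · refine setIntegral_congr_fun hms fun z (hz : 0 < z.2) => ?_
      have hz2 : 0 < inner ℝ (φ z) e := by rwa [hin]
      have hne := ne_neg_of_inner_pos he hz2
      rw [hw_def, norm_fderiv_comp_inversion (hu.differentiable one_ne_zero) hne,
        one_sub_norm_inversion_sq he hne, hin]
      field_simp
      ring
    · intro z hz
      have : fderiv ℝ w (φ z) = 0 :=
        image_eq_zero_of_notMem_tsupport fun h => hz (by
          have : 0 < inner ℝ (φ z) e := hKO (hwK (tsupport_fderiv_subset ℝ h))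
          rwa [hin] at this)
      rw [this, norm_zero, zero_mul]
  have hpO : ContinuousOn (fun y : ℝ => (y ^ m)⁻¹) (Ioi 0) :=
    ContinuousOn.inv₀ (by fun_prop) fun y hy => pow_ne_zero _ (ne_of_gt hy)
  have hwc : Continuous fun z => ‖fderiv ℝ w (φ z)‖ :=
    ((hw.continuous_fderiv one_ne_zero).comp φ.continuous).norm
  have hwsub : tsupport (fun z => ‖fderiv ℝ w (φ z)‖) ⊆ φ ⁻¹' tsupport w :=
    closure_minimal (fun z (hz : ‖fderiv ℝ w (φ z)‖ ≠ 0) => support_fderiv_subset ℝ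
      (norm_ne_zero_iff.1 hz)) ((isClosed_tsupport w).preimage φ.continuous)
  have hpos : ∀ z ∈ φ ⁻¹' tsupport w, 0 < z.2 := fun z hz => by
    have : 0 < inner ℝ (φ z) e := hKO (hwK hz)
    rwa [hin] at this
  have hcs : HasCompactSupport fun z => ‖fderiv ℝ w (φ z)‖ :=
    ((hws.fderiv ℝ).comp_homeomorph φ.toHomeomorph).norm
  have hgs : tsupport (gradNorm U) ⊆ tsupport U := tsupport_gradNorm_subset U
  rw [h1, h2, h3]
  refine (pow_add_pow_le_integral_gradNorm hm hU hUs hUO).trans ?_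
  have hn : ∀ z, 0 ≤ gradNorm U z * (z.2 ^ m)⁻¹ := fun z => by
    by_cases hz : z ∈ tsupport U
    · have := hUO z hz
      exact mul_nonneg (gradNorm_nonneg _ _) (by positivity)
    · rw [image_eq_zero_of_notMem_tsupport fun h => hz (hgs h), zero_mul]
  refine pow_le_pow_left₀ (integral_nonneg hn) ?_ _
  refine integral_mono_of_nonneg (Eventually.of_forall hn)
    ((continuous_mul_comp_snd hwc isOpen_Ioi hpO fun z hz =>
      hpos z (hwsub hz)).integrable_of_hasCompactSupport
      (HasCompactSupport.mul_right (f := fun z => ‖fderiv ℝ w (φ z)‖) hcs))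
    (Eventually.of_forall fun z => ?_)
  by_cases hz : z ∈ tsupport U
  · have := hUO z hz
    exact mul_le_mul_of_nonneg_right
      (gradNorm_comp_le φ hφ (hw.differentiable one_ne_zero) z) (by positivity)
  · have h0 : gradNorm U z = 0 := image_eq_zero_of_notMem_tsupport fun h => hz (hgs h)
    by_cases hz2 : z ∈ φ ⁻¹' tsupport w
    · have := hpos z hz2
      simp only [h0, zero_mul]
      positivity
    · have : ‖fderiv ℝ w (φ z)‖ = 0 := image_eq_zero_of_notMem_tsupport
        (f := fun z => ‖fderiv ℝ w (φ z)‖) fun h => hz2 (hwsub h)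
      simp only [h0, this, zero_mul, le_refl]

end BallToHalfSpace

/-- The Mugelli–Talenti type Sobolev inequality in `ℍⁿ` for `p = 1`. -/
theorem mugelli_talenti_hyperbolic_p_one (n : ℕ) (hn : 2 ≤ n)
    (u : EuclideanSpace ℝ (Fin n) → ℝ) (hu : ContDiff ℝ (⊤ : ℕ∞) u)
    (hsupp : tsupport u ⊆ Metric.ball (0 : EuclideanSpace ℝ (Fin n)) 1) :
    ((n : ℝ) - 1) ^ (n : ℝ) *
        (∫ x in Metric.ball (0 : EuclideanSpace ℝ (Fin n)) 1,
            |u x| * (2 / (1 - ‖x‖ ^ 2)) ^ (n : ℝ)) ^ (n : ℝ)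
      + ((n : ℝ) * unitBallVol n ^ (1 / (n : ℝ))) ^ (n : ℝ) *
        (∫ x in Metric.ball (0 : EuclideanSpace ℝ (Fin n)) 1,
            |u x| ^ ((n : ℝ) / ((n : ℝ) - 1)) * (2 / (1 - ‖x‖ ^ 2)) ^ (n : ℝ)) ^ ((n : ℝ) - 1)
      ≤ (∫ x in Metric.ball (0 : EuclideanSpace ℝ (Fin n)) 1,
            ((1 - ‖x‖ ^ 2) / 2) * ‖fderiv ℝ u x‖ * (2 / (1 - ‖x‖ ^ 2)) ^ (n : ℝ)) ^ (n : ℝ) := by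
  obtain ⟨m, rfl⟩ : ∃ m, n = m + 1 := ⟨n - 1, by omega⟩
  have h := pow_add_pow_le_ball (by omega : 0 < m) (hu.of_le (by exact_mod_cast le_top)) hsupp
  have h1 : ((m + 1 : ℕ) : ℝ) - 1 = m := by push_cast; ring
  have h2 : ((m + 1 : ℕ) : ℝ) / m = ((m : ℝ) + 1) / m := by push_cast; rfl
  simp only [h1, h2, rpow_natCast]
  rw [mul_pow, one_div, rpow_inv_natCast_pow (unitBallVol_pos _).le (Nat.succ_ne_zero m)]
  push_cast
  exact h
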